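/- Let λ and α both be partitions with exactly 3 distinct part sizes, μ and β rectangles, with λ/μ and α/β basic connected skew diagrams. If s_{λ/μ} = s_{α/β} then λ/μ = α/β. -/

import Mathlib

open YoungDiagram
open scoped Classical

namespace LRSkew

/-- The cells of the skew diagram `lam/mu`. -/
def skewCells (lam mu : YoungDiagram) : Finset (ℕ × ℕ) := lam.cells \ mu.cells

/-- A semistandard filling of the skew shape `lam/mu`: entries are positive exactly on the
cells of the shape, rows are weakly increasing and columns are strictly increasing. -/
def IsSSYT (lam mu : YoungDiagram) (T : ℕ × ℕ → ℕ) : Prop :=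
  (∀ p, p ∈ skewCells lam mu ↔ T p ≠ 0) ∧
  (∀ i j1 j2, (i, j1) ∈ skewCells lam mu → (i, j2) ∈ skewCells lam mu → j1 ≤ j2 →
    T (i, j1) ≤ T (i, j2)) ∧
  (∀ i1 i2 j, (i1, j) ∈ skewCells lam mu → (i2, j) ∈ skewCells lam mu → i1 < i2 →
    T (i1, j) < T (i2, j))

/-- The number of entries equal to `k` among the cells read (in the reverse reading word:
right to left along rows, top row first) up to position `(i,j)`. -/
def prefixCount (lam mu : YoungDiagram) (T : ℕ × ℕ → ℕ) (i j k : ℕ) : ℕ :=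
  ((skewCells lam mu).filter fun p => (p.1 < i ∨ (p.1 = i ∧ j ≤ p.2)) ∧ T p = k).card

/-- The reverse reading word of the filling is a lattice word. -/
def IsLattice (lam mu : YoungDiagram) (T : ℕ × ℕ → ℕ) : Prop :=
  ∀ i j k, prefixCount lam mu T i j (k + 2) ≤ prefixCount lam mu T i j (k + 1)

/-- The number of entries of the filling equal to `k`. -/
def content (lam mu : YoungDiagram) (T : ℕ × ℕ → ℕ) (k : ℕ) : ℕ :=
  ((skewCells lam mu).filter fun p => T p = k).card

/-- A Littlewood–Richardson tableau of shape `lam/mu` and content `nu`. -/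
def IsLR (lam mu nu : YoungDiagram) (T : ℕ × ℕ → ℕ) : Prop :=
  IsSSYT lam mu T ∧ IsLattice lam mu T ∧ ∀ i, content lam mu T (i + 1) = nu.rowLen i

/-- The Littlewood–Richardson coefficient `c(lam; mu, nu)`. -/
noncomputable def lrCoeff (lam mu nu : YoungDiagram) : ℕ :=
  if mu ≤ lam then {T : ℕ × ℕ → ℕ | IsLR lam mu nu T}.ncard else 0

/-- Equality of the skew Schur functions `s_{lam/mu} = s_{alp/bet}`, expressed through
their expansions into Schur functions. -/
def SchurEq (lam mu alp bet : YoungDiagram) : Prop :=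
  ∀ nu : YoungDiagram, lrCoeff lam mu nu = lrCoeff alp bet nu

/-- The rectangular Young diagram `(k^l)` with `l` rows of length `k`. -/
def rect (k l : ℕ) : YoungDiagram :=
  ⟨Finset.range l ×ˢ Finset.range k, by
    intro a b hba ha
    simp only [Finset.coe_product, Set.mem_prod, Finset.mem_coe, Finset.mem_range] at ha ⊢
    exact ⟨lt_of_le_of_lt hba.1 ha.1, lt_of_le_of_lt hba.2 ha.2⟩⟩

/-- The complement of `nu` in the rectangle `(k^l)`, rotated by 180 degrees so that it is
again a partition: its parts are `(k - nu_l, …, k - nu_1)`. -/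
def complRect (k l : ℕ) (nu : YoungDiagram) : YoungDiagram :=
  ⟨(rect k l).cells.filter fun p => (l - 1 - p.1, k - 1 - p.2) ∉ nu, by
    intro a b hba ha
    simp only [Finset.coe_filter, Set.mem_setOf_eq, mem_cells] at ha ⊢
    refine ⟨(rect k l).isLowerSet hba ha.1, fun hmem => ha.2 ?_⟩
    exact nu.isLowerSet
      (Prod.mk_le_mk.mpr ⟨Nat.sub_le_sub_left hba.1 _, Nat.sub_le_sub_left hba.2 _⟩) hmem⟩

/-- The staircase partition `(n, n-1, …, 2, 1)`. -/
def staircase (n : ℕ) : YoungDiagram :=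
  ⟨(Finset.range n ×ˢ Finset.range n).filter fun p => p.1 + p.2 < n, by
    intro a b hba ha
    simp only [Finset.coe_filter, Set.mem_setOf_eq, Finset.mem_product, Finset.mem_range] at ha ⊢
    exact ⟨⟨lt_of_le_of_lt hba.1 ha.1.1, lt_of_le_of_lt hba.2 ha.1.2⟩,
      lt_of_le_of_lt (Nat.add_le_add hba.1 hba.2) ha.2⟩⟩

/-- A basic skew diagram: no empty rows and no empty columns. -/
def IsBasic (lam mu : YoungDiagram) : Prop :=
  (∀ i, i < lam.colLen 0 → mu.rowLen i < lam.rowLen i) ∧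
  (∀ j, j < lam.rowLen 0 → mu.colLen j < lam.colLen j)

/-- A (basic) skew diagram is connected iff consecutive rows share a column. -/
def IsConnectedSkew (lam mu : YoungDiagram) : Prop :=
  ∀ i, i + 1 < lam.colLen 0 → mu.rowLen i < lam.rowLen (i + 1)

/-- The number of distinct (positive) part sizes of a partition. -/
def dp (lam : YoungDiagram) : ℕ :=
  ((Finset.range (lam.colLen 0)).image fun i => lam.rowLen i).card

/-- A partition is a rectangle: all its parts are equal. -/
def IsRect (mu : YoungDiagram) : Prop :=
  ∀ i, i < mu.colLen 0 → mu.rowLen i = mu.rowLen 0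

/-- Cells of a skew diagram in the same connected component: the reflexive–transitive
closure of sharing a row or a column. -/
def SameComp (s : Finset (ℕ × ℕ)) : ℕ × ℕ → ℕ × ℕ → Prop :=
  Relation.ReflTransGen fun a b => a ∈ s ∧ b ∈ s ∧ (a.1 = b.1 ∨ a.2 = b.2)

/-- Two finite sets of boxes agree up to translation or 180°-rotation of each connected
component independently. -/
def UpToTransRot (s t : Finset (ℕ × ℕ)) : Prop :=
  ∃ f : ℕ × ℕ → ℕ × ℕ, Set.BijOn f ↑s ↑t ∧
    ∀ p ∈ s, ∀ q ∈ s, SameComp s p q →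
      (((f q).1 : ℤ) - (f p).1 = (q.1 : ℤ) - p.1 ∧ ((f q).2 : ℤ) - (f p).2 = (q.2 : ℤ) - p.2) ∨
      (((f q).1 : ℤ) - (f p).1 = (p.1 : ℤ) - q.1 ∧ ((f q).2 : ℤ) - (f p).2 = (p.2 : ℤ) - q.2)


section
/-- Reduced Littlewood–Richardson arrays: `n s v` counts the entries `v+1` in row `s` of the free
lower-left part `D`; the forced part of the filling has row lengths `R`. -/
structure Sk (l : ℕ) (R D : ℕ → ℕ) (n : ℕ → ℕ → ℕ) : Prop where
  lo : ∀ s v, v < s → n s v = 0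
  hi : ∀ s v, s + l < v → n s v = 0
  row : ∀ s, ∑ v ∈ Finset.range (s + l + 1), n s v = D s
  col : ∀ s v, ∑ w ∈ Finset.range (v + 1), n (s + 1) w ≤ ∑ w ∈ Finset.range v, n s w
  lat : ∀ s v, R (v + 1) + ∑ u ∈ Finset.range (s + 1), n u (v + 1) ≤
    R v + ∑ u ∈ Finset.range s, n u v

/-- The set of contents of reduced arrays. -/
def Supp (l : ℕ) (R D ν : ℕ → ℕ) : Prop :=
  ∃ n, Sk l R D n ∧ ∀ v, ν v = R v + ∑ s ∈ Finset.range (v + 1), n s v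

/-- Indicator of a column of length `r`. -/
def cl (r i : ℕ) : ℕ := if i < r then 1 else 0

theorem sum_range_ext {f : ℕ → ℕ} {a b : ℕ} (hab : a ≤ b) (h : ∀ i, a ≤ i → f i = 0) :
    ∑ i ∈ Finset.range b, f i = ∑ i ∈ Finset.range a, f i := by
  symm
  apply Finset.sum_subset
  · intro x; simp; omega
  · intro x _ hx; apply h; simpa using hx

theorem Sk.row_le {l R D n} (h : Sk l R D n) (s m : ℕ) :
    ∑ v ∈ Finset.range m, n s v ≤ D s := by
  rw [← h.row s]
  by_cases hm : m ≤ s + l + 1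
  · exact Finset.sum_le_sum_of_subset (by intro x; simp; omega)
  · rw [sum_range_ext (a := s + l + 1) (b := m) (by omega) (fun i hi => h.hi s i (by omega))]

theorem Sk.row_eq {l R D n} (h : Sk l R D n) (s m : ℕ) (hm : s + l < m) :
    ∑ v ∈ Finset.range m, n s v = D s := by
  rw [← h.row s]
  rw [sum_range_ext (a := s + l + 1) (b := m) (by omega) (fun i hi => h.hi s i (by omega))]

theorem Sk.le_D {l R D n} (h : Sk l R D n) (s v : ℕ) : n s v ≤ D s := by
  refine le_trans ?_ (h.row_le s (v+1))
  exact Finset.single_le_sum (f := fun v => n s v) (by simp) (by simp)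

/-- Prefix sums of the content in terms of the array. -/
theorem Sk.pre {l R D n} (h : Sk l R D n) (p : ℕ) :
    ∑ v ∈ Finset.range p, (R v + ∑ s ∈ Finset.range (v + 1), n s v) =
      ∑ v ∈ Finset.range p, R v + ∑ s ∈ Finset.range p, ∑ v ∈ Finset.range p, n s v := by
  rw [Finset.sum_add_distrib, Finset.sum_comm (s := Finset.range p)]
  congr 1
  apply Finset.sum_congr rfl
  intro v hv
  rw [Finset.mem_range] at hv
  exact (sum_range_ext (by omega) (fun i hi => h.lo i v (by omega))).symm

theorem Sk.pre_le {l R D n} (h : Sk l R D n) (p : ℕ) :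
    ∑ v ∈ Finset.range p, (R v + ∑ s ∈ Finset.range (v + 1), n s v) ≤
      ∑ v ∈ Finset.range p, (R v + D v) := by
  rw [h.pre, Finset.sum_add_distrib]
  gcongr with s
  exact h.row_le _ _

/-- If the prefix sum of the content is maximal, the first rows have no large entries. -/
theorem Sk.pre_eq {l R D n} (h : Sk l R D n) (p : ℕ)
    (he : ∑ v ∈ Finset.range p, (R v + ∑ s ∈ Finset.range (v + 1), n s v) =
      ∑ v ∈ Finset.range p, (R v + D v)) :
    ∀ s, s < p → ∑ v ∈ Finset.range p, n s v = D s ∧ ∀ v, p ≤ v → n s v = 0 := by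
  rw [h.pre, Finset.sum_add_distrib, add_right_inj,
    Finset.sum_eq_sum_iff_of_le (fun i _ => h.row_le _ _)] at he
  intro s hs
  have h1 := he s (by simpa using hs)
  refine ⟨h1, fun v hv => ?_⟩
  have h2 := h.row_le s (v+1)
  rw [Finset.sum_range_succ] at h2
  have h3 : ∑ v ∈ Finset.range p, n s v ≤ ∑ w ∈ Finset.range v, n s w :=
    Finset.sum_le_sum_of_subset (by intro x; simp; omega)
  omega

theorem Supp.pre_le {l R D ν} (h : Supp l R D ν) (p : ℕ) :
    ∑ v ∈ Finset.range p, ν v ≤ ∑ v ∈ Finset.range p, (R v + D v) := by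
  obtain ⟨n, hn, hν⟩ := h
  simp only [hν]
  exact hn.pre_le p

/-- Upper bound for the `I` invariant. -/
theorem Supp.upI {l R D ν} (h : Supp l R D ν) (p t : ℕ)
    (h1 : ∑ v ∈ Finset.range p, ν v = ∑ v ∈ Finset.range p, (R v + D v))
    (h2 : ∑ v ∈ Finset.range (p+2), ν v = ∑ v ∈ Finset.range (p+2), (R v + D v))
    (h3 : ν p + t = R p + D p) : t + R (p+1) ≤ R p ∧ t + D (p+1) ≤ D p := by
  obtain ⟨n, hn, hν⟩ := h
  simp only [hν] at h1 h2
  have e1 := hn.pre_eq p h1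
  have e2 := hn.pre_eq (p+2) h2
  have hz : ∀ s, s < p → n s p = 0 := fun s hs => (e1 s hs).2 p le_rfl
  have hz' : ∀ s, s < p → n s (p+1) = 0 := fun s hs => (e1 s hs).2 (p+1) (by omega)
  rw [hν, Finset.sum_range_succ, Finset.sum_eq_zero (by simpa using hz)] at h3
  have hlt : ∑ v ∈ Finset.range p, n p v = 0 :=
    Finset.sum_eq_zero (fun v hv => hn.lo p v (by simpa using hv))
  have a1 := (e2 p (by omega)).1
  rw [Finset.sum_range_succ, Finset.sum_range_succ, hlt] at a1
  have a2 := (e2 (p+1) (by omega)).1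
  have c := hn.col p (p+1)
  rw [a2, Finset.sum_range_succ, hlt] at c
  have la := hn.lat p p
  rw [Finset.sum_range_succ, Finset.sum_eq_zero (by simpa using hz'),
    Finset.sum_eq_zero (by simpa using hz)] at la
  omega

/-- Lower bound for the `W` invariant. -/
theorem Supp.upW {l R D ν} (h : Supp l R D ν) (p x : ℕ)
    (h1 : ∑ v ∈ Finset.range p, ν v = ∑ v ∈ Finset.range p, (R v + D v))
    (h3 : ν p + x = R p + D p) : x ≤ D p ∧ x + R (p+l) ≤ R p := by
  obtain ⟨n, hn, hν⟩ := h
  simp only [hν] at h1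
  have e1 := hn.pre_eq p h1
  have hz : ∀ v, p ≤ v → ∑ s ∈ Finset.range p, n s v = 0 := fun v hv =>
    Finset.sum_eq_zero (fun s hs => (e1 s (by simpa using hs)).2 v hv)
  rw [hν, Finset.sum_range_succ, hz p le_rfl] at h3
  have hb : ∀ j, ∑ v ∈ Finset.range (p+1+j), n p v + R (p + j) ≤ n p p + R p := by
    intro j
    induction j with
    | zero =>
      simp only [add_zero]
      rw [Finset.sum_range_succ, Finset.sum_eq_zero (fun v hv => hn.lo p v (by simpa using hv))]
      omega
    | succ j ih =>
      rw [← add_assoc, Finset.sum_range_succ]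
      have la := hn.lat p (p+j)
      rw [Finset.sum_range_succ, hz _ (by omega), hz _ (by omega)] at la
      rw [show p + 1 + j = p + j + 1 by omega] at ih ⊢
      rw [show p + (j+1) = p+j+1 by omega]
      omega
  have := hb l
  rw [hn.row_eq p _ (by omega)] at this
  omega

/-- Upper bound for the `A` invariant. -/
theorem Supp.upG {l R D ν} (h : Supp l R D ν) (q x : ℕ)
    (h1 : ∑ v ∈ Finset.range (q+1), ν v = ∑ v ∈ Finset.range (q+1), (R v + D v))
    (h3 : ν q = R q + D q + x) : x + R q ≤ R 0 ∧ x + D q ≤ D (q - l) := by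
  obtain ⟨n, hn, hν⟩ := h
  simp only [hν] at h1
  have e1 := hn.pre_eq (q+1) h1
  rw [hν] at h3
  constructor
  · have hb : ∀ j, j ≤ q → R q + ∑ s ∈ Finset.range q, n s q ≤
        R (q - j) + ∑ s ∈ Finset.range (q-j), n s (q-j) := by
      intro j
      induction j with
      | zero => simp
      | succ j ih =>
        intro hj
        refine le_trans (ih (by omega)) ?_
        have := hn.lat (q - (j+1)) (q - (j+1))
        rw [show q - (j+1) + 1 = q - j by omega] at this
        exact this
    have := hb q le_rfl
    simp at this
    rw [Finset.sum_range_succ] at h3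
    have := hn.le_D q q
    omega
  · have hd : ∀ s, s < q → n s q + D (s+1) ≤ D s := by
      intro s hs
      have c := hn.col s q
      have a := (e1 (s+1) (by omega)).1
      have b := (e1 s (by omega)).1
      rw [Finset.sum_range_succ] at b
      omega
    have hb : ∀ j, j ≤ l → j ≤ q → ∑ s ∈ Finset.range (q+1), n s q ≤
        ∑ s ∈ Finset.range (q - j), n s q + D (q - j) := by
      intro j
      induction j with
      | zero =>
        intro _ _
        rw [Finset.sum_range_succ]
        have := hn.le_D q q
        simp; exact this
      | succ j ih =>
        intro h1 h2
        have i := ih (by omega) (by omega)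
        have d := hd (q - (j+1)) (by omega)
        rw [show q - (j+1) + 1 = q - j by omega] at d
        have e : ∑ s ∈ Finset.range (q - j), n s q =
            ∑ s ∈ Finset.range (q - (j+1)), n s q + n (q - (j+1)) q := by
          rw [← Finset.sum_range_succ, show q - (j+1) + 1 = q - j by omega]
        omega
    by_cases hq : q ≤ l
    · have := hb q hq le_rfl
      simp at this
      rw [show q - l = 0 by omega]
      omega
    · have := hb l le_rfl (by omega)
      rw [Finset.sum_eq_zero (s := Finset.range (q-l))] at this
      · omega
      · intro s hs
        rw [Finset.mem_range] at hs
        exact hn.hi s q (by omega)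

/-- Length bound. -/
theorem Supp.upL {l R D ν} {m : ℕ} (h : Supp l R D ν) (hR : ∀ i, m ≤ i → R i = 0)
    (hD : ∀ i, m ≤ i + l → D i = 0) : ∀ i, m ≤ i → ν i = 0 := by
  obtain ⟨n, hn, hν⟩ := h
  intro i hi
  rw [hν, hR i hi, zero_add]
  apply Finset.sum_eq_zero
  intro s hs
  by_cases hs' : s + l < i
  · exact hn.hi _ _ hs'
  · have := hn.le_D s i
    rw [hD s (by omega)] at this
    omega

end

section
theorem Supp.add {l R D ν R' D' ν'} (h : Supp l R D ν) (h' : Supp l R' D' ν') :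
    Supp l (fun i => R i + R' i) (fun i => D i + D' i) (fun i => ν i + ν' i) := by
  obtain ⟨n, hn, hν⟩ := h
  obtain ⟨n', hn', hν'⟩ := h'
  refine ⟨fun s v => n s v + n' s v, ⟨?_, ?_, ?_, ?_, ?_⟩, ?_⟩
  · intro s v h; simp [hn.lo s v h, hn'.lo s v h]
  · intro s v h; simp [hn.hi s v h, hn'.hi s v h]
  · intro s; simp only [Finset.sum_add_distrib, hn.row, hn'.row]
  · intro s v; simp only [Finset.sum_add_distrib]
    exact add_le_add (hn.col s v) (hn'.col s v)
  · intro s v; simp only [Finset.sum_add_distrib]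
    have := hn.lat s v
    have := hn'.lat s v
    omega
  · intro v; simp only [Finset.sum_add_distrib, hν, hν']; omega

theorem Supp.congr {l R D ν R' D' ν'} (h : Supp l R D ν) (hR : ∀ i, R' i = R i)
    (hD : ∀ i, D' i = D i) (hν : ∀ i, ν' i = ν i) : Supp l R' D' ν' := by
  rw [show R' = R from funext hR, show D' = D from funext hD, show ν' = ν from funext hν]
  exact h

theorem Supp.top {l R D} (hR : Antitone R) (hD : Antitone D) :
    Supp l R D (fun i => R i + D i) := by
  refine ⟨fun s v => if v = s then D s else 0, ⟨?_, ?_, ?_, ?_, ?_⟩, ?_⟩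
  · intro s v h; rw [if_neg (by omega)]
  · intro s v h; rw [if_neg (by omega)]
  · intro s; simp
  · intro s v
    simp only [Finset.sum_ite_eq', Finset.mem_range]
    have := hD (Nat.le_succ s)
    split_ifs <;> first | omega | exact this
  · intro s v
    simp only [Finset.sum_ite_eq, Finset.mem_range]
    have := hD (Nat.le_succ v)
    have := hR (Nat.le_succ v)
    simp only [Nat.succ_eq_add_one] at *
    split_ifs <;> omega
  · intro v
    simp

theorem Supp.pair (l r d t : ℕ) (h1 : t ≤ r) (h2 : t ≤ d) (h3 : r ≤ t + l) :
    Supp l (cl r) (cl d) (fun i => cl (r + d - t) i + cl t i) := by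
  have key : ∀ v m, ∑ s ∈ Finset.range m,
      (if s < d ∧ v = (if s < t then s else r + s - t) then 1 else 0) =
      if (v < t ∧ v < m) ∨ (r ≤ v ∧ v + t < m + r ∧ v + t < d + r) then 1 else 0 := by
    intro v m
    induction m with
    | zero => simp; omega
    | succ m ih =>
      rw [Finset.sum_range_succ, ih]
      split_ifs <;> omega
  have key2 : ∀ s m, ∑ v ∈ Finset.range m,
      (if s < d ∧ v = (if s < t then s else r + s - t) then 1 else 0) =
      if s < d ∧ (if s < t then s else r + s - t) < m then 1 else 0 := by
    intro s m
    induction m with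
    | zero => simp
    | succ m ih =>
      rw [Finset.sum_range_succ, ih]
      split_ifs <;> omega
  refine ⟨fun s v => if s < d ∧ v = (if s < t then s else r + s - t) then 1 else 0,
    ⟨?_, ?_, ?_, ?_, ?_⟩, ?_⟩
  · intro s v h; split_ifs <;> omega
  · intro s v h; split_ifs <;> omega
  · intro s; rw [key2]; unfold cl; split_ifs <;> omega
  · intro s v; rw [key2, key2]; split_ifs <;> omega
  · intro s v; rw [key, key]; unfold cl; split_ifs <;> omega
  · intro v; rw [key]; unfold cl; beta_reduce; split_ifs <;> omega

theorem sum_cl (r p : ℕ) : ∑ i ∈ Finset.range p, cl r i = min r p := by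
  induction p with
  | zero => simp
  | succ p ih => rw [Finset.sum_range_succ, ih]; unfold cl; split_ifs <;> omega

/-- Peeling off a column. -/
theorem anti_peel {R : ℕ → ℕ} (hR : Antitone R) (r : ℕ) (hr : 0 < r) (h : R r < R (r - 1)) :
    ∃ R' : ℕ → ℕ, Antitone R' ∧ ∀ i, R i = R' i + cl r i := by
  have hp : ∀ i, i < r → 0 < R i := fun i hi => by
    have := hR (show i ≤ r - 1 by omega); omega
  refine ⟨fun i => R i - cl r i, ?_, ?_⟩
  · apply antitone_nat_of_succ_le
    intro i
    have := hR (Nat.le_succ i)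
    simp only [Nat.succ_eq_add_one] at *
    unfold cl
    by_cases hi : i + 1 = r
    · subst hi; simp at h ⊢; omega
    · split_ifs <;> omega
  · intro i
    unfold cl
    beta_reduce
    split_ifs with h
    · have := hp i h; omega
    · omega

theorem exists_drop {R : ℕ → ℕ} (a b : ℕ) (h : R b < R a) (hab : a ≤ b) :
    ∃ r, a < r ∧ r ≤ b ∧ R r < R (r - 1) := by
  by_contra! hc
  have : ∀ j, a + j ≤ b → R a ≤ R (a + j) := by
    intro j
    induction j with
    | zero => simp
    | succ j ih =>
      intro hj
      have := hc (a + (j+1)) (by omega) hj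
      rw [show a + (j+1) - 1 = a + j by omega] at this
      exact (ih (by omega)).trans this
  have := this (b - a) (by omega)
  rw [show a + (b - a) = b by omega] at this
  omega

/-- Existence of a content realising `W`. -/
theorem exW (l p m : ℕ) (x : ℕ) : ∀ (R D : ℕ → ℕ), Antitone R → Antitone D →
    (∀ i, m ≤ i → D i = 0) → x ≤ D p → x + R (p + l) ≤ R p →
    ∃ ν, Supp l R D ν ∧ ∑ v ∈ Finset.range p, ν v = ∑ v ∈ Finset.range p, (R v + D v) ∧
      ν p + x = R p + D p := by
  induction x with
  | zero =>
    intro R D hR hD _ _ _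
    exact ⟨_, Supp.top hR hD, rfl, rfl⟩
  | succ x ih =>
    intro R D hR hD hm h1 h2
    obtain ⟨r, hr1, hr2, hr3⟩ := exists_drop (R := R) p (p + l) (by omega) (by omega)
    have hpm : p < m := by
      by_contra hc
      have := hm p (by omega)
      omega
    obtain ⟨d, hd1, hd2, hd3⟩ := exists_drop (R := D) p m
      (by rw [hm m le_rfl]; omega) (by omega)
    obtain ⟨R', hR', eR⟩ := anti_peel hR r (by omega) hr3
    obtain ⟨D', hD', eD⟩ := anti_peel hD d (by omega) hd3
    have c1 : cl r p = 1 := by simp [cl, hr1]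
    have c2 : cl d p = 1 := by simp [cl, hd1]
    have c3 : cl r (p + l) = 0 := by simp [cl, hr2]
    obtain ⟨ν, a1, a2, a3⟩ := ih R' D' hR' hD' (fun i hi => by have := hm i hi; have := eD i; omega)
      (by have := eD p; omega) (by have := eR p; have := eR (p+l); omega)
    refine ⟨_, (a1.add (Supp.pair l r d p (by omega) (by omega) (by omega))).congr eR eD
      (fun _ => rfl), ?_, ?_⟩
    · simp only [Finset.sum_add_distrib, eR, eD, sum_cl] at a2 ⊢
      omega
    · have := eR p
      have := eD p
      have : cl (r + d - p) p = 1 := by unfold cl; split_ifs <;> omega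
      have : cl p p = 0 := by simp [cl]
      omega

/-- Existence of a content realising `I`. -/
theorem exI (l p : ℕ) (hl : 0 < l) (x : ℕ) : ∀ (R D : ℕ → ℕ), Antitone R → Antitone D →
    x + D (p + 1) ≤ D p → x + R (p + 1) ≤ R p →
    ∃ ν, Supp l R D ν ∧ ∑ v ∈ Finset.range p, ν v = ∑ v ∈ Finset.range p, (R v + D v) ∧
      ∑ v ∈ Finset.range (p + 2), ν v = ∑ v ∈ Finset.range (p + 2), (R v + D v) ∧
      ν p + x = R p + D p := by
  induction x with
  | zero =>
    intro R D hR hD _ _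
    exact ⟨_, Supp.top hR hD, rfl, rfl, rfl⟩
  | succ x ih =>
    intro R D hR hD h1 h2
    obtain ⟨R', hR', eR⟩ := anti_peel hR (p+1) (by omega) (by simp; omega)
    obtain ⟨D', hD', eD⟩ := anti_peel hD (p+1) (by omega) (by simp; omega)
    have c1 : cl (p+1) p = 1 := by simp [cl]
    have c3 : cl (p+1) (p + 1) = 0 := by simp [cl]
    obtain ⟨ν, a1, a2, a4, a3⟩ := ih R' D' hR' hD'
      (by have := eD p; have := eD (p+1); omega) (by have := eR p; have := eR (p+1); omega)
    refine ⟨_, (a1.add (Supp.pair l (p+1) (p+1) p (by omega) (by omega) (by omega))).congr eR eD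
      (fun _ => rfl), ?_, ?_, ?_⟩
    · simp only [Finset.sum_add_distrib, eR, eD, sum_cl] at a2 ⊢
      omega
    · simp only [Finset.sum_add_distrib, eR, eD, sum_cl] at a4 ⊢
      omega
    · have := eR p
      have := eD p
      have : cl (p + 1 + (p + 1) - p) p = 1 := by unfold cl; split_ifs <;> omega
      have : cl p p = 0 := by simp [cl]
      omega

/-- Existence of a content for the invariant `A`, first kind. -/
theorem exG1 (l q : ℕ) (hl : 0 < l) (hq : 0 < q) (x : ℕ) : ∀ (R D : ℕ → ℕ), Antitone R →
    Antitone D → x + D q ≤ D (q - 1) → x + R q ≤ R 0 →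
    ∃ ν, Supp l R D ν ∧
      ∑ v ∈ Finset.range (q + 1), ν v = ∑ v ∈ Finset.range (q + 1), (R v + D v) ∧
      ν q = R q + D q + x := by
  induction x with
  | zero =>
    intro R D hR hD _ _
    exact ⟨_, Supp.top hR hD, rfl, rfl⟩
  | succ x ih =>
    intro R D hR hD h1 h2
    obtain ⟨r, hr1, hr2, hr3⟩ := exists_drop (R := R) 0 q (by omega) (by omega)
    obtain ⟨R', hR', eR⟩ := anti_peel hR r (by omega) hr3
    obtain ⟨D', hD', eD⟩ := anti_peel hD q (by omega) (by omega)
    have c1 : cl r q = 0 := by simp [cl, hr2]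
    have c2 : cl r 0 = 1 := by simp [cl, hr1]
    have c3 : cl q q = 0 := by simp [cl]
    have c4 : cl q (q - 1) = 1 := by simp [cl, hq]
    obtain ⟨ν, a1, a2, a3⟩ := ih R' D' hR' hD'
      (by have := eD q; have := eD (q-1); omega) (by have := eR q; have := eR 0; omega)
    refine ⟨_, (a1.add (Supp.pair l r q (r-1) (by omega) (by omega) (by omega))).congr eR eD
      (fun _ => rfl), ?_, ?_⟩
    · simp only [Finset.sum_add_distrib, eR, eD, sum_cl] at a2 ⊢
      omega
    · have := eR q
      have := eD q
      have : cl (r + q - (r - 1)) q = 1 := by unfold cl; split_ifs <;> omega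
      have : cl (r - 1) q = 0 := by unfold cl; split_ifs <;> omega
      omega

/-- Existence of a content for the invariant `A`, second kind. -/
theorem exG2 (l q : ℕ) (hl : 0 < l) (hq : 0 < q) (x : ℕ) : ∀ (R D : ℕ → ℕ), Antitone R →
    Antitone D → x + R q ≤ R (q - 1) → x + D q ≤ D (q - l) →
    ∃ ν, Supp l R D ν ∧
      ∑ v ∈ Finset.range (q + 1), ν v = ∑ v ∈ Finset.range (q + 1), (R v + D v) ∧
      ν q = R q + D q + x := by
  induction x with
  | zero =>
    intro R D hR hD _ _
    exact ⟨_, Supp.top hR hD, rfl, rfl⟩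
  | succ x ih =>
    intro R D hR hD h1 h2
    obtain ⟨r, hr1, hr2, hr3⟩ := exists_drop (R := D) (q - l) q (by omega) (by omega)
    obtain ⟨R', hR', eR⟩ := anti_peel hR q (by omega) (by omega)
    obtain ⟨D', hD', eD⟩ := anti_peel hD r (by omega) hr3
    have c1 : cl r q = 0 := by simp [cl, hr2]
    have c2 : cl r (q - l) = 1 := by simp [cl, hr1]
    have c3 : cl q q = 0 := by simp [cl]
    have c4 : cl q (q - 1) = 1 := by simp [cl, hq]
    obtain ⟨ν, a1, a2, a3⟩ := ih R' D' hR' hD'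
      (by have := eR q; have := eR (q-1); omega) (by have := eD q; have := eD (q-l); omega)
    refine ⟨_, (a1.add (Supp.pair l q r (r-1) (by omega) (by omega) (by omega))).congr eR eD
      (fun _ => rfl), ?_, ?_⟩
    · simp only [Finset.sum_add_distrib, eR, eD, sum_cl] at a2 ⊢
      omega
    · have := eR q
      have := eD q
      have : cl (q + r - (r - 1)) q = 1 := by unfold cl; split_ifs <;> omega
      have : cl (r - 1) q = 0 := by unfold cl; split_ifs <;> omega
      omega

/-- Existence of a content of maximal length. -/
theorem exL (l a d : ℕ) {R D : ℕ → ℕ} (hR : Antitone R) (hD : Antitone D)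
    (ha : l ≤ a) (had : a ≤ d + l) (hd : 0 < d) (ha' : 0 < a)
    (h1 : R a < R (a - 1)) (h2 : D d < D (d - 1)) :
    ∃ ν, Supp l R D ν ∧ 0 < ν (d + l - 1) := by
  obtain ⟨R', hR', eR⟩ := anti_peel hR a (by omega) h1
  obtain ⟨D', hD', eD⟩ := anti_peel hD d (by omega) h2
  refine ⟨_, ((Supp.top hR' hD').add (Supp.pair l a d (a-l) (by omega) (by omega)
    (by omega))).congr eR eD (fun _ => rfl), ?_⟩
  have : cl (a + d - (a - l)) (d + l - 1) = 1 := by unfold cl; split_ifs <;> omega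
  omega

end

section
/-- Numerical consequences of an inclusion of supports. -/
structure Cmp (l : ℕ) (R D : ℕ → ℕ) (l' : ℕ) (R' D' : ℕ → ℕ) : Prop where
  T : ∀ p, R p + D p = R' p + D' p
  W : ∀ p x, x ≤ D p → x + R (p + l) ≤ R p → x ≤ D' p ∧ x + R' (p + l') ≤ R' p
  I : 0 < l → ∀ p x, x + R (p + 1) ≤ R p → x + D (p + 1) ≤ D p →
    x + R' (p + 1) ≤ R' p ∧ x + D' (p + 1) ≤ D' p
  G1 : 0 < l → ∀ q x, 0 < q → x + D q ≤ D (q - 1) → x + R q ≤ R 0 →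
    x + R' q ≤ R' 0 ∧ x + D' q ≤ D' (q - l')
  G2 : 0 < l → ∀ q x, 0 < q → x + R q ≤ R (q - 1) → x + D q ≤ D (q - l) →
    x + R' q ≤ R' 0 ∧ x + D' q ≤ D' (q - l')

theorem Cmp.mk' {l R D l' R' D' m} (hR : Antitone R) (hD : Antitone D)
    (hR' : Antitone R') (hD' : Antitone D') (hm : ∀ i, m ≤ i → D i = 0)
    (h : ∀ ν, Supp l R D ν ↔ Supp l' R' D' ν) : Cmp l R D l' R' D' := by
  have hpre : ∀ p, ∑ v ∈ Finset.range p, (R v + D v) = ∑ v ∈ Finset.range p, (R' v + D' v) := by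
    intro p
    apply le_antisymm
    · exact ((h _).1 (Supp.top hR hD)).pre_le p
    · exact ((h _).2 (Supp.top hR' hD')).pre_le p
  have hT : ∀ p, R p + D p = R' p + D' p := by
    intro p
    have h1 := hpre p
    have h2 := hpre (p+1)
    rw [Finset.sum_range_succ, Finset.sum_range_succ, h1] at h2
    omega
  refine ⟨hT, ?_, ?_, ?_, ?_⟩
  · intro p x h1 h2
    obtain ⟨ν, a, b, c⟩ := exW l p m x R D hR hD hm h1 h2
    exact ((h ν).1 a).upW p x (by rw [b, hpre]) (by rw [c, hT])
  · intro hl p x h1 h2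
    obtain ⟨ν, a, b, c, d⟩ := exI l p hl x R D hR hD h2 h1
    exact ((h ν).1 a).upI p x (by rw [b, hpre]) (by rw [c, hpre]) (by rw [d, hT])
  · intro hl q x hq h1 h2
    obtain ⟨ν, a, b, c⟩ := exG1 l q hl hq x R D hR hD h1 h2
    exact ((h ν).1 a).upG q x (by rw [b, hpre]) (by rw [c, hT])
  · intro hl q x hq h1 h2
    obtain ⟨ν, a, b, c⟩ := exG2 l q hl hq x R D hR hD h1 h2
    exact ((h ν).1 a).upG q x (by rw [b, hpre]) (by rw [c, hT])

/-- Jumps of `R` and `D` agree as unordered pairs. -/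
theorem Cmp.J {l R D l' R' D'} (h : Cmp l R D l' R' D') (h' : Cmp l' R' D' l R D)
    (hR : Antitone R) (hD : Antitone D) (hR' : Antitone R') (hD' : Antitone D')
    (hl : 0 < l) (hl' : 0 < l') (c : ℕ) (hc : 0 < c) :
    (R (c-1) - R c = R' (c-1) - R' c ∧ D (c-1) - D c = D' (c-1) - D' c) ∨
    (R (c-1) - R c = D' (c-1) - D' c ∧ D (c-1) - D c = R' (c-1) - R' c) := by
  obtain ⟨p, rfl⟩ : ∃ p, c = p + 1 := ⟨c - 1, by omega⟩
  simp only [Nat.add_sub_cancel]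
  have t1 := h.T p
  have t2 := h.T (p+1)
  have a1 := hR (Nat.le_succ p)
  have a2 := hD (Nat.le_succ p)
  have a3 := hR' (Nat.le_succ p)
  have a4 := hD' (Nat.le_succ p)
  simp only [Nat.succ_eq_add_one] at *
  have b1 := h.I hl p (min (R p - R (p+1)) (D p - D (p+1))) (by omega) (by omega)
  have b2 := h'.I hl' p (min (R' p - R' (p+1)) (D' p - D' (p+1))) (by omega) (by omega)
  omega

/-- `L` is the maximal length of a content. -/
def Len (l : ℕ) (R D : ℕ → ℕ) (L : ℕ) : Prop :=
  0 < L ∧ (∃ ν, Supp l R D ν ∧ 0 < ν (L - 1)) ∧ ∀ ν, Supp l R D ν → ∀ i, L ≤ i → ν i = 0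

theorem Len.le {l R D l' R' D' L L'} (h : ∀ ν, Supp l R D ν ↔ Supp l' R' D' ν)
    (h1 : Len l R D L) (h2 : Len l' R' D' L') : L ≤ L' := by
  obtain ⟨a, ⟨ν, b, c⟩, _⟩ := h1
  by_contra hc
  have := h2.2.2 ν ((h ν).1 b) (L - 1) (by omega)
  omega

/-- Type 1/2: `k ≤ a3`. -/
structure Ty1 (l : ℕ) (R D : ℕ → ℕ) (x y z k r s d : ℕ) : Prop where
  l0 : 0 < l
  x0 : 0 < x
  y0 : 0 < y
  k0 : 0 < k
  r0 : 0 < r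
  rs : r < s
  sL : s < d + l
  d0 : 0 < d
  z0 : z = 0 → l < s
  hR : ∀ i, R i = (if i < r then x else 0) + (if i < s then y else 0) + (if i < d + l then z else 0)
  hD : ∀ i, D i = if i < d then k else 0

/-- Type 3: `a3 < k < a2`. -/
structure Ty3 (l : ℕ) (R D : ℕ → ℕ) (x y z w r s c d : ℕ) : Prop where
  l0 : 0 < l
  x0 : 0 < x
  y0 : 0 < y
  z0 : 0 < z
  w0 : 0 < w
  r0 : 0 < r
  rs : r < s
  c0 : 0 < c
  cs : c + l = s
  cd : c < d
  hR : ∀ i, R i = (if i < r then x else 0) + (if i < s then y else 0)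
  hD : ∀ i, D i = (if i < c then z else 0) + (if i < d then w else 0)

/-- Type 4/5: `a2 ≤ k < a1`. -/
structure Ty5 (l : ℕ) (R D : ℕ → ℕ) (x y z w r c d e : ℕ) : Prop where
  l0 : 0 < l
  x0 : 0 < x
  z0 : 0 < z
  w0 : 0 < w
  c0 : 0 < c
  cl : c + l = r
  cd : c < d
  de : d < e
  hR : ∀ i, R i = (if i < r then x else 0)
  hD : ∀ i, D i = (if i < c then y else 0) + (if i < d then z else 0) + (if i < e then w else 0)

theorem anti_ite (r x : ℕ) : Antitone (fun i => if i < r then x else 0) := by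
  intro a b hab
  dsimp only
  split_ifs <;> omega

theorem Ty1.aR {l R D x y z k r s d} (h : Ty1 l R D x y z k r s d) : Antitone R := by
  rw [show R = _ from funext h.hR]
  exact ((anti_ite _ _).add (anti_ite _ _)).add (anti_ite _ _)
theorem Ty1.aD {l R D x y z k r s d} (h : Ty1 l R D x y z k r s d) : Antitone D := by
  rw [show D = _ from funext h.hD]
  exact anti_ite _ _
theorem Ty3.aR {l R D x y z w r s c d} (h : Ty3 l R D x y z w r s c d) : Antitone R := by
  rw [show R = _ from funext h.hR]
  exact (anti_ite _ _).add (anti_ite _ _)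
theorem Ty3.aD {l R D x y z w r s c d} (h : Ty3 l R D x y z w r s c d) : Antitone D := by
  rw [show D = _ from funext h.hD]
  exact (anti_ite _ _).add (anti_ite _ _)
theorem Ty5.aR {l R D x y z w r c d e} (h : Ty5 l R D x y z w r c d e) : Antitone R := by
  rw [show R = _ from funext h.hR]
  exact anti_ite _ _
theorem Ty5.aD {l R D x y z w r c d e} (h : Ty5 l R D x y z w r c d e) : Antitone D := by
  rw [show D = _ from funext h.hD]
  exact ((anti_ite _ _).add (anti_ite _ _)).add (anti_ite _ _)

theorem Ty1.len {l R D x y z k r s d} (h : Ty1 l R D x y z k r s d) : Len l R D (d + l) := by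
  obtain ⟨l0, x0, y0, k0, r0, rs, sL, d0, z0, hR, hD⟩ := id h
  refine ⟨by omega, ?_, ?_⟩
  · by_cases hz : z = 0
    · exact exL l s d h.aR h.aD (by have := z0 hz; omega) (by omega) d0 (by omega)
        (by rw [hR, hR]; split_ifs <;> omega) (by rw [hD, hD]; split_ifs <;> omega)
    · exact exL l (d+l) d h.aR h.aD (by omega) (by omega) d0 (by omega)
        (by rw [hR, hR]; split_ifs <;> omega) (by rw [hD, hD]; split_ifs <;> omega)
  · intro ν hν
    exact hν.upL (fun i hi => by rw [hR]; split_ifs <;> omega)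
      (fun i hi => by rw [hD]; split_ifs <;> omega)

theorem Ty3.len {l R D x y z w r s c d} (h : Ty3 l R D x y z w r s c d) : Len l R D (d + l) := by
  obtain ⟨l0, x0, y0, z0, w0, r0, rs, c0, cs, cd, hR, hD⟩ := id h
  refine ⟨by omega, ?_, ?_⟩
  · exact exL l s d h.aR h.aD (by omega) (by omega) (by omega) (by omega)
        (by rw [hR, hR]; split_ifs <;> omega) (by rw [hD, hD]; split_ifs <;> omega)
  · intro ν hν
    exact hν.upL (fun i hi => by rw [hR]; split_ifs <;> omega)
      (fun i hi => by rw [hD]; split_ifs <;> omega)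

theorem Ty5.len {l R D x y z w r c d e} (h : Ty5 l R D x y z w r c d e) : Len l R D (e + l) := by
  obtain ⟨l0, x0, z0, w0, c0, cl, cd, de, hR, hD⟩ := id h
  refine ⟨by omega, ?_, ?_⟩
  · exact exL l r e h.aR h.aD (by omega) (by omega) (by omega) (by omega)
        (by rw [hR, hR]; split_ifs <;> omega) (by rw [hD, hD]; split_ifs <;> omega)
  · intro ν hν
    exact hν.upL (fun i hi => by rw [hR]; split_ifs <;> omega)
      (fun i hi => by rw [hD]; split_ifs <;> omega)

/-- Support of the `W` invariant. -/
def Ws (l : ℕ) (R D : ℕ → ℕ) (p : ℕ) : Prop := 1 ≤ D p ∧ 1 + R (p + l) ≤ R p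

theorem Cmp.ws {l R D l' R' D'} (h : Cmp l R D l' R' D') {p : ℕ} : Ws l R D p → Ws l' R' D' p :=
  fun hw => h.W p 1 hw.1 hw.2

theorem Ty1.ws {l R D x y z k r s d} (h : Ty1 l R D x y z k r s d) (p : ℕ) :
    Ws l R D p ↔ p < d ∧ ((p < r ∧ r ≤ p + l) ∨ (p < s ∧ s ≤ p + l)) := by
  obtain ⟨l0, x0, y0, k0, r0, rs, sL, d0, z0, hR, hD⟩ := id h
  unfold Ws
  rw [hR, hR, hD]
  split_ifs <;> omega

theorem Ty3.ws {l R D x y z w r s c d} (h : Ty3 l R D x y z w r s c d) (p : ℕ) :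
    Ws l R D p ↔ p < d ∧ ((p < r ∧ r ≤ p + l) ∨ (p < s ∧ s ≤ p + l)) := by
  obtain ⟨l0, x0, y0, z0, w0, r0, rs, c0, cs, cd, hR, hD⟩ := id h
  unfold Ws
  rw [hR, hR, hD]
  split_ifs <;> omega

theorem Ty5.ws {l R D x y z w r c d e} (h : Ty5 l R D x y z w r c d e) (p : ℕ) :
    Ws l R D p ↔ p < e ∧ p < r ∧ r ≤ p + l := by
  obtain ⟨l0, x0, z0, w0, c0, cl, cd, de, hR, hD⟩ := id h
  unfold Ws
  rw [hR, hR, hD]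
  split_ifs <;> omega

/-- Number of jumps at a position. -/
def Ct (R D : ℕ → ℕ) (c : ℕ) : ℕ :=
  (if R c < R (c-1) then 1 else 0) + (if D c < D (c-1) then 1 else 0)

theorem ite_jump (c r x : ℕ) (hc : 0 < c) : (if c - 1 < r then x else 0) =
    (if c < r then x else 0) + (if c = r then x else 0) := by
  split_ifs <;> omega

theorem Ty1.jR {l R D x y z k r s d} (h : Ty1 l R D x y z k r s d) (c : ℕ) (hc : 0 < c) :
    R (c - 1) = R c + ((if c = r then x else 0) + (if c = s then y else 0) +
      (if c = d + l then z else 0)) := by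
  rw [h.hR, h.hR, ite_jump _ _ _ hc, ite_jump _ _ _ hc, ite_jump _ _ _ hc]; ring
theorem Ty1.jD {l R D x y z k r s d} (h : Ty1 l R D x y z k r s d) (c : ℕ) (hc : 0 < c) :
    D (c - 1) = D c + (if c = d then k else 0) := by
  rw [h.hD, h.hD, ite_jump _ _ _ hc]
theorem Ty3.jR {l R D x y z w r s c d} (h : Ty3 l R D x y z w r s c d) (u : ℕ) (hc : 0 < u) :
    R (u - 1) = R u + ((if u = r then x else 0) + (if u = s then y else 0)) := by
  rw [h.hR, h.hR, ite_jump _ _ _ hc, ite_jump _ _ _ hc]; ring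
theorem Ty3.jD {l R D x y z w r s c d} (h : Ty3 l R D x y z w r s c d) (u : ℕ) (hc : 0 < u) :
    D (u - 1) = D u + ((if u = c then z else 0) + (if u = d then w else 0)) := by
  rw [h.hD, h.hD, ite_jump _ _ _ hc, ite_jump _ _ _ hc]; ring
theorem Ty5.jR {l R D x y z w r c d e} (h : Ty5 l R D x y z w r c d e) (u : ℕ) (hc : 0 < u) :
    R (u - 1) = R u + (if u = r then x else 0) := by
  rw [h.hR, h.hR, ite_jump _ _ _ hc]
theorem Ty5.jD {l R D x y z w r c d e} (h : Ty5 l R D x y z w r c d e) (u : ℕ) (hc : 0 < u) :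
    D (u - 1) = D u + ((if u = c then y else 0) + (if u = d then z else 0)
      + (if u = e then w else 0)) := by
  rw [h.hD, h.hD, ite_jump _ _ _ hc, ite_jump _ _ _ hc, ite_jump _ _ _ hc]; ring

theorem Ty1.ct {l R D x y z k r s d} (h : Ty1 l R D x y z k r s d) (c : ℕ) (hc : 0 < c) :
    Ct R D c = (if c = r then 1 else 0) + (if c = s then 1 else 0) + (if c = d then 1 else 0)
      + (if c = d + l ∧ z ≠ 0 then 1 else 0) := by
  obtain ⟨l0, x0, y0, k0, r0, rs, sL, d0, z0, hR, hD⟩ := id h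
  unfold Ct
  rw [h.jR c hc, h.jD c hc]
  clear hR hD h
  simp only [lt_add_iff_pos_right]
  split_ifs <;> omega

theorem Ty3.ct {l R D x y z w r s c d} (h : Ty3 l R D x y z w r s c d) (u : ℕ) (hc : 0 < u) :
    Ct R D u = (if u = r then 1 else 0) + (if u = s then 1 else 0) + (if u = c then 1 else 0)
      + (if u = d then 1 else 0) := by
  obtain ⟨l0, x0, y0, z0, w0, r0, rs, c0, cs, cd, hR, hD⟩ := id h
  unfold Ct
  rw [h.jR u hc, h.jD u hc]
  clear hR hD h
  simp only [lt_add_iff_pos_right]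
  split_ifs <;> omega

theorem Ty5.ct {l R D x y z w r c d e} (h : Ty5 l R D x y z w r c d e) (u : ℕ) (hc : 0 < u) :
    Ct R D u = (if u = r then 1 else 0) + (if u = d then 1 else 0) + (if u = e then 1 else 0)
      + (if u = c ∧ y ≠ 0 then 1 else 0) := by
  obtain ⟨l0, x0, z0, w0, c0, cl, cd, de, hR, hD⟩ := id h
  unfold Ct
  rw [h.jR u hc, h.jD u hc]
  clear hR hD h
  simp only [lt_add_iff_pos_right]
  split_ifs <;> omega

theorem Cmp.ct {l R D l' R' D'} (h : Cmp l R D l' R' D') (h' : Cmp l' R' D' l R D)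
    (hR : Antitone R) (hD : Antitone D) (hR' : Antitone R') (hD' : Antitone D')
    (hl : 0 < l) (hl' : 0 < l') (c : ℕ) (hc : 0 < c) : Ct R D c = Ct R' D' c := by
  have := h.J h' hR hD hR' hD' hl hl' c hc
  unfold Ct
  split_ifs <;> omega

end

section
theorem ms_eq {M N : Multiset ℕ} (hM : ∀ a ∈ M, 0 < a) (hN : ∀ a ∈ N, 0 < a)
    (h : ∀ u, 0 < u → M.count u = N.count u) : M = N := by
  ext u
  rcases Nat.eq_zero_or_pos u with rfl | hu
  · rw [Multiset.count_eq_zero_of_notMem, Multiset.count_eq_zero_of_notMem]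
    · intro hc; exact absurd (hN _ hc) (lt_irrefl _)
    · intro hc; exact absurd (hM _ hc) (lt_irrefl _)
  · exact h u hu

theorem mult3 {a b c a' b' c' : ℕ} (ha : 0 < a) (hb : 0 < b) (hc : 0 < c)
    (ha' : 0 < a') (hb' : 0 < b') (hc' : 0 < c')
    (h : ∀ u, 0 < u → (if u = a then 1 else 0) + (if u = b then 1 else 0) +
      (if u = c then 1 else 0) = (if u = a' then 1 else 0) + (if u = b' then 1 else 0) +
      (if u = c' then 1 else 0)) :
    a + b + c = a' + b' + c' ∧ (a = a' ∨ a = b' ∨ a = c') ∧ (b = a' ∨ b = b' ∨ b = c') ∧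
    (c = a' ∨ c = b' ∨ c = c') := by
  have e : ({a, b, c} : Multiset ℕ) = {a', b', c'} := by
    apply ms_eq
    · simp [ha, hb, hc]
    · simp [ha', hb', hc']
    · intro u hu
      have := h u hu
      simp only [Multiset.insert_eq_cons, Multiset.count_cons, Multiset.count_singleton]
      omega
  refine ⟨?_, ?_, ?_, ?_⟩
  · have := congrArg Multiset.sum e
    simpa [add_assoc] using this
  · have : a ∈ ({a', b', c'} : Multiset ℕ) := by rw [← e]; simp
    simpa using this
  · have : b ∈ ({a', b', c'} : Multiset ℕ) := by rw [← e]; simp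
    simpa using this
  · have : c ∈ ({a', b', c'} : Multiset ℕ) := by rw [← e]; simp
    simpa using this

theorem mult34 {a b c a' b' c' d' : ℕ} (ha : 0 < a) (hb : 0 < b) (hc : 0 < c)
    (ha' : 0 < a') (hb' : 0 < b') (hc' : 0 < c') (hd' : 0 < d')
    (h : ∀ u, 0 < u → (if u = a then 1 else 0) + (if u = b then 1 else 0) +
      (if u = c then 1 else 0) = (if u = a' then 1 else 0) + (if u = b' then 1 else 0) +
      (if u = c' then 1 else 0) + (if u = d' then 1 else 0)) : False := by
  have e : ({a, b, c} : Multiset ℕ) = {a', b', c', d'} := by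
    apply ms_eq
    · simp [ha, hb, hc]
    · simp [ha', hb', hc', hd']
    · intro u hu
      have := h u hu
      simp only [Multiset.insert_eq_cons, Multiset.count_cons, Multiset.count_singleton]
      omega
  have := congrArg Multiset.card e
  simp at this

theorem mult4 {a b c d a' b' c' d' : ℕ} (ha : 0 < a) (hb : 0 < b) (hc : 0 < c) (hd : 0 < d)
    (ha' : 0 < a') (hb' : 0 < b') (hc' : 0 < c') (hd' : 0 < d')
    (h : ∀ u, 0 < u → (if u = a then 1 else 0) + (if u = b then 1 else 0) +
      (if u = c then 1 else 0) + (if u = d then 1 else 0) =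
      (if u = a' then 1 else 0) + (if u = b' then 1 else 0) +
      (if u = c' then 1 else 0) + (if u = d' then 1 else 0)) :
    a + b + c + d = a' + b' + c' + d' ∧ (a = a' ∨ a = b' ∨ a = c' ∨ a = d') ∧
    (b = a' ∨ b = b' ∨ b = c' ∨ b = d') ∧ (c = a' ∨ c = b' ∨ c = c' ∨ c = d') ∧
    (d = a' ∨ d = b' ∨ d = c' ∨ d = d') := by
  have e : ({a, b, c, d} : Multiset ℕ) = {a', b', c', d'} := by
    apply ms_eq
    · simp [ha, hb, hc, hd]
    · simp [ha', hb', hc', hd']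
    · intro u hu
      have := h u hu
      simp only [Multiset.insert_eq_cons, Multiset.count_cons, Multiset.count_singleton]
      omega
  refine ⟨?_, ?_, ?_, ?_, ?_⟩
  · have := congrArg Multiset.sum e
    simpa [add_assoc] using this
  · have : a ∈ ({a', b', c', d'} : Multiset ℕ) := by rw [← e]; simp
    simpa using this
  · have : b ∈ ({a', b', c', d'} : Multiset ℕ) := by rw [← e]; simp
    simpa using this
  · have : c ∈ ({a', b', c', d'} : Multiset ℕ) := by rw [← e]; simp
    simpa using this
  · have : d ∈ ({a', b', c', d'} : Multiset ℕ) := by rw [← e]; simp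
    simpa using this

section pairs
variable {l : ℕ} {R D : ℕ → ℕ} {l' : ℕ} {R' D' : ℕ → ℕ}

theorem sep13 {x y z k r s d x' y' z' w' r' s' c' d'}
    (h : Cmp l R D l' R' D') (h' : Cmp l' R' D' l R D)
    (t : Ty1 l R D x y z k r s d) (t' : Ty3 l' R' D' x' y' z' w' r' s' c' d')
    (hL : d + l = d' + l') : False := by
  have hct := h.ct h' t.aR t.aD t'.aR t'.aD t.l0 t'.l0
  obtain ⟨l0, x0, y0, k0, r0, rs, sL, d0, z0, hR, hD⟩ := id t
  obtain ⟨l0', x0', y0', z0', w0', r0', rs', c0', cs', cd', hR', hD'⟩ := id t'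
  have hz : z = 0 := by
    have := h.T (d + l - 1)
    rw [hR, hD, hR', hD'] at this
    split_ifs at this <;> omega
  refine mult34 (a := r) (b := s) (c := d) (a' := r') (b' := s') (c' := c') (d' := d')
    r0 (by omega) d0 r0' (by omega) c0' (by omega) ?_
  intro u hu
  have := hct u hu
  rw [t.ct u hu, t'.ct u hu] at this
  simpa [hz] using this

theorem sep15 {x y z k r s d x' y' z' w' r' c' d' e'}
    (h : Cmp l R D l' R' D') (h' : Cmp l' R' D' l R D)
    (t : Ty1 l R D x y z k r s d) (t' : Ty5 l' R' D' x' y' z' w' r' c' d' e')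
    (hL : d + l = e' + l') : False := by
  have hct := h.ct h' t.aR t.aD t'.aR t'.aD t.l0 t'.l0
  obtain ⟨l0, x0, y0, k0, r0, rs, sL, d0, z0, hR, hD⟩ := id t
  obtain ⟨l0', x0', z0', w0', c0', cl', cd', de', hR', hD'⟩ := id t'
  have hz : z = 0 := by
    have := h.T (d + l - 1)
    rw [hR, hD, hR', hD'] at this
    split_ifs at this <;> omega
  by_cases hy : y' = 0
  · have hm := mult3 (a := r) (b := s) (c := d) (a' := r') (b' := d') (c' := e')
      r0 (by omega) d0 (by omega) (by omega) (by omega) (by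
        intro u hu
        have := hct u hu
        rw [t.ct u hu, t'.ct u hu] at this
        simpa [hz, hy] using this)
    have w1 : ∀ p, _ ↔ _ := fun p => (t.ws p).symm.trans (⟨h.ws, h'.ws⟩ : Ws l R D p ↔ Ws l' R' D' p)
    have w2 : ∀ p, _ ↔ _ := fun p => (w1 p).trans (t'.ws p)
    have v1 := w2 (min s d - 1)
    have v2 := w2 (min r' e' - 1)
    have v3 := w2 (r' - l' - 1)
    have v4 := w2 (r' - l')
    clear w1 w2 hR hD hR' hD' hct h h' t t'
    have := z0 hz
    omega
  · refine mult34 (a := r) (b := s) (c := d) (a' := r') (b' := d') (c' := e') (d' := c')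
      r0 (by omega) d0 (by omega) (by omega) (by omega) (by omega) ?_
    intro u hu
    have := hct u hu
    rw [t.ct u hu, t'.ct u hu] at this
    simpa [hz, hy] using this

theorem sep35 {x y z w r s c d x' y' z' w' r' c' d' e'}
    (h : Cmp l R D l' R' D') (h' : Cmp l' R' D' l R D)
    (t : Ty3 l R D x y z w r s c d) (t' : Ty5 l' R' D' x' y' z' w' r' c' d' e')
    (hL : d + l = e' + l') : False := by
  have hct := h.ct h' t.aR t.aD t'.aR t'.aD t.l0 t'.l0
  obtain ⟨l0, x0, y0, z0, w0, r0, rs, c0, cs, cd, hR, hD⟩ := id t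
  obtain ⟨l0', x0', z0', w0', c0', cl', cd', de', hR', hD'⟩ := id t'
  by_cases hy : y' = 0
  · refine mult34 (a := r') (b := d') (c := e') (a' := r) (b' := s) (c' := c) (d' := d)
      (by omega) (by omega) (by omega) r0 (by omega) (by omega) (by omega) ?_
    intro u hu
    have := hct u hu
    rw [t.ct u hu, t'.ct u hu] at this
    simpa [hy] using this.symm
  · have hm := mult4 (a := r) (b := s) (c := c) (d := d) (a' := r') (b' := d') (c' := e')
      (d' := c')
      r0 (by omega) (by omega) (by omega) (by omega) (by omega) (by omega) (by omega) (by
        intro u hu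
        have := hct u hu
        rw [t.ct u hu, t'.ct u hu] at this
        simpa [hy] using this)
    have w1 : ∀ p, _ ↔ _ := fun p => (t.ws p).symm.trans (⟨h.ws, h'.ws⟩ : Ws l R D p ↔ Ws l' R' D' p)
    have w2 : ∀ p, _ ↔ _ := fun p => (w1 p).trans (t'.ws p)
    have v1 := w2 (min s d - 1)
    have v2 := w2 (min r' e' - 1)
    have v3 := w2 (r' - l' - 1)
    have v4 := w2 c
    have v5 := w2 (c - 1)
    clear w1 w2 hR hD hR' hD' hct h h' t t'
    omega

end pairs

end

section
section pairs
variable {l : ℕ} {R D : ℕ → ℕ} {l' : ℕ} {R' D' : ℕ → ℕ}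

theorem same1_pos {x y z k r s d x' y' z' k' r' s' d'}
    (h : Cmp l R D l' R' D') (h' : Cmp l' R' D' l R D)
    (t : Ty1 l R D x y z k r s d) (t' : Ty1 l' R' D' x' y' z' k' r' s' d')
    (hL : d + l = d' + l') : z = z' ∧ r + s + d = r' + s' + d' ∧
      (r = r' ∨ r = s' ∨ r = d') ∧ (s = r' ∨ s = s' ∨ s = d') ∧ (d = r' ∨ d = s' ∨ d = d') ∧
      (r' = r ∨ r' = s ∨ r' = d) ∧ min s d = min s' d' := by
  have hct := h.ct h' t.aR t.aD t'.aR t'.aD t.l0 t'.l0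
  obtain ⟨l0, x0, y0, k0, r0, rs, sL, d0, z0, hR, hD⟩ := id t
  obtain ⟨l0', x0', y0', k0', r0', rs', sL', d0', z0', hR', hD'⟩ := id t'
  have hz : z = z' := by
    have := h.T (d + l - 1)
    rw [hR, hD, hR', hD'] at this
    split_ifs at this <;> omega
  have hu : ∀ u, 0 < u → (if u = r then 1 else 0) + (if u = s then 1 else 0) +
      (if u = d then 1 else 0) = (if u = r' then 1 else 0) + (if u = s' then 1 else 0) +
      (if u = d' then 1 else 0) := by
    intro u hu
    have := hct u hu
    rw [t.ct u hu, t'.ct u hu, hz, hL] at this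
    exact Nat.add_right_cancel this
  have hm := mult3 r0 (by omega) d0 r0' (by omega) d0' hu
  have hm' := mult3 r0' (by omega) d0' r0 (by omega) d0 (fun u hu' => (hu u hu').symm)
  refine ⟨hz, hm.1, hm.2.1, hm.2.2.1, hm.2.2.2, hm'.2.1, ?_⟩
  have w1 : ∀ p, _ ↔ _ := fun p => (t.ws p).symm.trans (⟨h.ws, h'.ws⟩ : Ws l R D p ↔ Ws l' R' D' p)
  have w2 : ∀ p, _ ↔ _ := fun p => (w1 p).trans (t'.ws p)
  have v1 := w2 (min s d - 1)
  have v2 := w2 (min s' d' - 1)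
  clear w1 w2 hR hD hR' hD' hct h h' t t' hm hm' hu
  omega

theorem same1_le {x y z k r s d x' y' z' k' r' s' d'}
    (h : Cmp l R D l' R' D') (h' : Cmp l' R' D' l R D)
    (t : Ty1 l R D x y z k r s d) (t' : Ty1 l' R' D' x' y' z' k' r' s' d')
    (hL : d + l = d' + l') : d' ≤ d := by
  have hp := same1_pos h h' t t' hL
  obtain ⟨l0, x0, y0, k0, r0, rs, sL, d0, z0, hR, hD⟩ := id t
  obtain ⟨l0', x0', y0', k0', r0', rs', sL', d0', z0', hR', hD'⟩ := id t'
  by_contra hc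
  have hrd : r ≤ d := by omega
  have := (h.G1 l0 d 1 d0 (by rw [hD, hD]; split_ifs <;> omega)
    (by rw [hR, hR]; split_ifs <;> omega)).2
  rw [hD', hD'] at this
  split_ifs at this <;> omega

theorem same1 {x y z k r s d x' y' z' k' r' s' d'}
    (h : Cmp l R D l' R' D') (h' : Cmp l' R' D' l R D)
    (t : Ty1 l R D x y z k r s d) (t' : Ty1 l' R' D' x' y' z' k' r' s' d')
    (hL : d + l = d' + l') : l = l' ∧ R = R' ∧ D = D' := by
  have hp := same1_pos h h' t t' hL
  have hd1 := same1_le h h' t t' hL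
  have hd2 := same1_le h' h t' t hL.symm
  obtain ⟨l0, x0, y0, k0, r0, rs, sL, d0, z0, hR, hD⟩ := id t
  obtain ⟨l0', x0', y0', k0', r0', rs', sL', d0', z0', hR', hD'⟩ := id t'
  obtain rfl : d = d' := by omega
  obtain rfl : l = l' := by omega
  obtain ⟨rfl, rfl⟩ : r = r' ∧ s = s' := by omega
  obtain rfl := hp.1
  have hJ := h.J h' t.aR t.aD t'.aR t'.aD l0 l0'
  have j1 := hJ r r0
  have j2 := hJ s (by omega)
  have j3 := hJ d d0
  rw [t.jR _ (by omega), t.jD _ (by omega), t'.jR _ (by omega), t'.jD _ (by omega)] at j1 j2 j3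
  simp only [Nat.add_sub_cancel_left] at j1 j2 j3
  suffices x = x' ∧ y = y' ∧ k = k' by
    obtain ⟨rfl, rfl, rfl⟩ := this
    exact ⟨rfl, funext fun i => by rw [hR, hR'], funext fun i => by rw [hD, hD']⟩
  have e1 : r ≠ s := by omega
  have e2 : r ≠ d + l := by omega
  have e3 : s ≠ d + l := by omega
  have e4 : d ≠ d + l := by omega
  by_cases c1 : d = r
  · subst c1
    have a1 := h.W (d-1) (min k (x+y)) (by rw [hD]; split_ifs <;> omega)
      (by rw [hR, hR]; split_ifs <;> omega)
    have a2 := h'.W (d-1) (min k' (x'+y')) (by rw [hD']; split_ifs <;> omega)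
      (by rw [hR', hR']; split_ifs <;> omega)
    rw [hR', hR', hD'] at a1
    rw [hR, hR, hD] at a2
    clear h h' hJ t t' hR hD hR' hD'
    simp [e1, e1.symm, e3, l0.ne'] at j1 j2
    split_ifs at a1 a2 <;> omega
  by_cases c2 : d = s
  · subst c2
    have a1 := h.G1 l0 d (min k (x+y)) (by omega) (by rw [hD, hD]; split_ifs <;> omega)
      (by rw [hR, hR]; split_ifs <;> omega)
    have a2 := h'.G1 l0 d (min k' (x'+y')) (by omega) (by rw [hD', hD']; split_ifs <;> omega)
      (by rw [hR', hR']; split_ifs <;> omega)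
    rw [hR', hR', hD', hD'] at a1
    rw [hR, hR, hD, hD] at a2
    clear h h' hJ t t' hR hD hR' hD'
    simp [e1, e1.symm, e2, l0.ne'] at j1 j2
    split_ifs at a1 a2 <;> omega
  · clear h h' hJ t t' hR hD hR' hD'
    simp [e1, e2, e3, e4, c1, c2, e1.symm, Ne.symm c1, Ne.symm c2] at j1 j2 j3
    omega

theorem same5_pos {x y z w r c d e x' y' z' w' r' c' d' e'}
    (h : Cmp l R D l' R' D') (h' : Cmp l' R' D' l R D)
    (t : Ty5 l R D x y z w r c d e) (t' : Ty5 l' R' D' x' y' z' w' r' c' d' e') :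
    y = y' ∧ c = c' ∧ r + d + e = r' + d' + e' ∧ min r e = min r' e' := by
  have hct := h.ct h' t.aR t.aD t'.aR t'.aD t.l0 t'.l0
  have hJ := h.J h' t.aR t.aD t'.aR t'.aD t.l0 t'.l0
  obtain ⟨l0, x0, z0, w0, c0, cl, cd, de, hR, hD⟩ := id t
  obtain ⟨l0', x0', z0', w0', c0', cl', cd', de', hR', hD'⟩ := id t'
  have w1 : ∀ p, _ ↔ _ := fun p => (t.ws p).symm.trans (⟨h.ws, h'.ws⟩ : Ws l R D p ↔ Ws l' R' D' p)
  have w2 : ∀ p, _ ↔ _ := fun p => (w1 p).trans (t'.ws p)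
  have v1 := w2 (min r e - 1)
  have v2 := w2 (min r' e' - 1)
  have v3 := w2 c
  have v4 := w2 c'
  have hc : c = c' := by clear w1 w2 hR hD hR' hD' hct h h' t t'; omega
  have he : min r e = min r' e' := by clear w1 w2 hR hD hR' hD' hct h h' t t'; omega
  subst hc
  have j := hJ c c0
  rw [t.jR _ (by omega), t.jD _ (by omega), t'.jR _ (by omega), t'.jD _ (by omega)] at j
  simp only [Nat.add_sub_cancel_left] at j
  have hy : y = y' := by
    split_ifs at j <;> omega
  refine ⟨hy, rfl, ?_, he⟩
  have hu : ∀ u, 0 < u → (if u = r then 1 else 0) + (if u = d then 1 else 0) +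
      (if u = e then 1 else 0) = (if u = r' then 1 else 0) + (if u = d' then 1 else 0) +
      (if u = e' then 1 else 0) := by
    intro u hu
    have := hct u hu
    rw [t.ct u hu, t'.ct u hu, hy] at this
    exact Nat.add_right_cancel this
  exact (mult3 (by omega) (by omega) (by omega) (by omega) (by omega) (by omega) hu).1

theorem same5_le {x y z w r c d e x' y' z' w' r' c' d' e'}
    (h : Cmp l R D l' R' D') (h' : Cmp l' R' D' l R D)
    (t : Ty5 l R D x y z w r c d e) (t' : Ty5 l' R' D' x' y' z' w' r' c' d' e')
    (hL : e + l = e' + l') : r' ≤ r := by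
  have hp := same5_pos h h' t t'
  obtain ⟨l0, x0, z0, w0, c0, cl, cd, de, hR, hD⟩ := id t
  obtain ⟨l0', x0', z0', w0', c0', cl', cd', de', hR', hD'⟩ := id t'
  by_contra hc
  have hrd : d ≤ r := by omega
  have := (h.G2 l0 r 1 (by omega) (by rw [hR, hR]; split_ifs <;> omega)
    (by rw [hD, hD]; split_ifs <;> omega)).1
  rw [hR', hR'] at this
  split_ifs at this <;> omega

theorem same5 {x y z w r c d e x' y' z' w' r' c' d' e'}
    (h : Cmp l R D l' R' D') (h' : Cmp l' R' D' l R D)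
    (t : Ty5 l R D x y z w r c d e) (t' : Ty5 l' R' D' x' y' z' w' r' c' d' e')
    (hL : e + l = e' + l') : l = l' ∧ R = R' ∧ D = D' := by
  have hp := same5_pos h h' t t'
  have hd1 := same5_le h h' t t' hL
  have hd2 := same5_le h' h t' t hL.symm
  obtain ⟨l0, x0, z0, w0, c0, cl, cd, de, hR, hD⟩ := id t
  obtain ⟨l0', x0', z0', w0', c0', cl', cd', de', hR', hD'⟩ := id t'
  obtain ⟨rfl, rfl, hp⟩ := hp
  obtain rfl : r = r' := by omega
  obtain rfl : l = l' := by omega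
  obtain rfl : e = e' := by omega
  obtain rfl : d = d' := by omega
  have hJ := h.J h' t.aR t.aD t'.aR t'.aD l0 l0'
  have j1 := hJ r (by omega)
  have j2 := hJ d (by omega)
  have j3 := hJ e (by omega)
  rw [t.jR _ (by omega), t.jD _ (by omega), t'.jR _ (by omega), t'.jD _ (by omega)] at j1 j2 j3
  simp only [Nat.add_sub_cancel_left] at j1 j2 j3
  suffices x = x' ∧ z = z' ∧ w = w' by
    obtain ⟨rfl, rfl, rfl⟩ := this
    exact ⟨rfl, funext fun i => by rw [hR, hR'], funext fun i => by rw [hD, hD']⟩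
  have e1 : r ≠ c := by omega
  have e2 : d ≠ c := by omega
  have e3 : e ≠ c := by omega
  have e4 : d ≠ e := by omega
  by_cases c1 : r = e
  · subst c1
    have a1 := h.W (d-1) (min (z+w) x) (by rw [hD]; split_ifs <;> omega)
      (by rw [hR, hR]; split_ifs <;> omega)
    have a2 := h'.W (d-1) (min (z'+w') x') (by rw [hD']; split_ifs <;> omega)
      (by rw [hR', hR']; split_ifs <;> omega)
    rw [hR', hR', hD'] at a1
    rw [hR, hR, hD] at a2
    clear h h' hJ t t' hR hD hR' hD'
    simp [e1, e2, e4, e4.symm] at j1 j2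
    split_ifs at a1 a2 <;> omega
  by_cases c2 : r = d
  · subst c2
    have a1 := h.W (r-1) (min (z+w) x) (by rw [hD]; split_ifs <;> omega)
      (by rw [hR, hR]; split_ifs <;> omega)
    have a2 := h'.W (r-1) (min (z'+w') x') (by rw [hD']; split_ifs <;> omega)
      (by rw [hR', hR']; split_ifs <;> omega)
    rw [hR', hR', hD'] at a1
    rw [hR, hR, hD] at a2
    clear h h' hJ t t' hR hD hR' hD'
    simp [e1, e2, e3, e4, e4.symm] at j1 j3
    split_ifs at a1 a2 <;> omega
  · clear h h' hJ t t' hR hD hR' hD'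
    simp [e1, e2, e3, e4, c1, c2, e4.symm, Ne.symm c1, Ne.symm c2] at j1 j2 j3
    omega

theorem same3_pos {x y z w r s c d x' y' z' w' r' s' c' d'}
    (h : Cmp l R D l' R' D') (h' : Cmp l' R' D' l R D)
    (t : Ty3 l R D x y z w r s c d) (t' : Ty3 l' R' D' x' y' z' w' r' s' c' d')
    (hL : d + l = d' + l') :
    c = c' ∧ r = r' ∧ min s d = min s' d' ∧ max s d = max s' d' := by
  have hct := h.ct h' t.aR t.aD t'.aR t'.aD t.l0 t'.l0
  obtain ⟨l0, x0, y0, z0, w0, r0, rs, c0, cs, cd, hR, hD⟩ := id t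
  obtain ⟨l0', x0', y0', z0', w0', r0', rs', c0', cs', cd', hR', hD'⟩ := id t'
  have hu : ∀ u, 0 < u → (if u = r then 1 else 0) + (if u = s then 1 else 0) +
      (if u = c then 1 else 0) + (if u = d then 1 else 0) =
      (if u = r' then 1 else 0) + (if u = s' then 1 else 0) +
      (if u = c' then 1 else 0) + (if u = d' then 1 else 0) := by
    intro u hu
    have := hct u hu
    rwa [t.ct u hu, t'.ct u hu] at this
  have hm := mult4 r0 (by omega) c0 (by omega) r0' (by omega) c0' (by omega) hu
  have hm' := mult4 r0' (by omega) c0' (by omega) r0 (by omega) c0 (by omega)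
    (fun u hu' => (hu u hu').symm)
  have w1 : ∀ p, _ ↔ _ := fun p => (t.ws p).symm.trans (⟨h.ws, h'.ws⟩ : Ws l R D p ↔ Ws l' R' D' p)
  have w2 : ∀ p, _ ↔ _ := fun p => (w1 p).trans (t'.ws p)
  have v1 := w2 (min s d - 1)
  have v2 := w2 (min s' d' - 1)
  have he : min s d = min s' d' := by clear w1 w2 hR hD hR' hD' hct h h' t t' hm hm' hu; omega
  clear w1 w2 hR hD hR' hD' hct h h' t t' v1 v2 hu
  omega

theorem same3_le {x y z w r s c d x' y' z' w' r' s' c' d'}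
    (h : Cmp l R D l' R' D') (h' : Cmp l' R' D' l R D)
    (t : Ty3 l R D x y z w r s c d) (t' : Ty3 l' R' D' x' y' z' w' r' s' c' d')
    (hL : d + l = d' + l') : d' ≤ d := by
  have hp := same3_pos h h' t t' hL
  obtain ⟨l0, x0, y0, z0, w0, r0, rs, c0, cs, cd, hR, hD⟩ := id t
  obtain ⟨l0', x0', y0', z0', w0', r0', rs', c0', cs', cd', hR', hD'⟩ := id t'
  by_contra hc
  have hrd : r ≤ d := by omega
  have := (h.G1 l0 d 1 (by omega) (by rw [hD, hD]; split_ifs <;> omega)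
    (by rw [hR, hR]; split_ifs <;> omega)).2
  rw [hD', hD'] at this
  split_ifs at this <;> omega

theorem same3 {x y z w r s c d x' y' z' w' r' s' c' d'}
    (h : Cmp l R D l' R' D') (h' : Cmp l' R' D' l R D)
    (t : Ty3 l R D x y z w r s c d) (t' : Ty3 l' R' D' x' y' z' w' r' s' c' d')
    (hL : d + l = d' + l') : l = l' ∧ R = R' ∧ D = D' := by
  have hp := same3_pos h h' t t' hL
  have hd1 := same3_le h h' t t' hL
  have hd2 := same3_le h' h t' t hL.symm
  obtain ⟨l0, x0, y0, z0, w0, r0, rs, c0, cs, cd, hR, hD⟩ := id t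
  obtain ⟨l0', x0', y0', z0', w0', r0', rs', c0', cs', cd', hR', hD'⟩ := id t'
  obtain ⟨rfl, rfl, hp⟩ := hp
  obtain rfl : d = d' := by omega
  obtain rfl : l = l' := by omega
  obtain rfl : s = s' := by omega
  have hJ := h.J h' t.aR t.aD t'.aR t'.aD l0 l0'
  have j1 := hJ r (by omega)
  have j2 := hJ s (by omega)
  have j3 := hJ c (by omega)
  have j4 := hJ d (by omega)
  rw [t.jR _ (by omega), t.jD _ (by omega), t'.jR _ (by omega), t'.jD _ (by omega)]
    at j1 j2 j3 j4
  simp only [Nat.add_sub_cancel_left] at j1 j2 j3 j4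
  suffices x = x' ∧ y = y' ∧ z = z' ∧ w = w' by
    obtain ⟨rfl, rfl, rfl, rfl⟩ := this
    exact ⟨rfl, funext fun i => by rw [hR, hR'], funext fun i => by rw [hD, hD']⟩
  have e1 : r ≠ s := by omega
  have e2 : s ≠ c := by omega
  have e3 : c ≠ d := by omega
  have hyw : y = y' ∧ w = w' := by
    by_cases c1 : s = d
    · subst c1
      have a1 := h.G1 l0 s (min w (x+y)) (by omega) (by rw [hD, hD]; split_ifs <;> omega)
        (by rw [hR, hR]; split_ifs <;> omega)
      have a2 := h'.G1 l0 s (min w' (x'+y')) (by omega) (by rw [hD', hD']; split_ifs <;> omega)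
        (by rw [hR', hR']; split_ifs <;> omega)
      rw [hR', hR', hD', hD'] at a1
      rw [hR, hR, hD, hD] at a2
      clear h h' hJ t t' hR hD hR' hD'
      simp [e1, e1.symm, e2] at j2
      split_ifs at a1 a2 <;> omega
    · by_cases c2 : r = d
      · subst c2
        have a1 := h.W (r-1) (min w (x+y)) (by rw [hD]; split_ifs <;> omega)
          (by rw [hR, hR]; split_ifs <;> omega)
        have a2 := h'.W (r-1) (min w' (x'+y')) (by rw [hD']; split_ifs <;> omega)
          (by rw [hR', hR']; split_ifs <;> omega)
        rw [hR', hR', hD'] at a1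
        rw [hR, hR, hD] at a2
        clear h h' hJ t t' hR hD hR' hD'
        simp [e1, e1.symm, e2, e3.symm] at j1 j2
        split_ifs at a1 a2 <;> omega
      · clear h h' hJ t t' hR hD hR' hD'
        simp [e1, e1.symm, e2, c1, c2, Ne.symm c1, Ne.symm c2, e3.symm] at j2 j4
        omega
  obtain ⟨rfl, rfl⟩ := hyw
  by_cases c3 : r = c
  · subst c3
    have a1 := h.W (r-1) (min (z+w) x) (by rw [hD]; split_ifs <;> omega)
      (by rw [hR, hR]; split_ifs <;> omega)
    have a2 := h'.W (r-1) (min (z'+w) x') (by rw [hD']; split_ifs <;> omega)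
      (by rw [hR', hR']; split_ifs <;> omega)
    rw [hR', hR', hD'] at a1
    rw [hR, hR, hD] at a2
    clear h h' hJ t t' hR hD hR' hD'
    simp [e1, e3] at j1
    split_ifs at a1 a2 <;> omega
  · clear h h' hJ t t' hR hD hR' hD'
    simp [e1, e2.symm, e3, c3, Ne.symm c3] at j1 j3
    split_ifs at j1 <;> omega

end pairs

end

section
/-- The possible shapes of the data attached to a skew diagram. -/
inductive Good (l : ℕ) (R D : ℕ → ℕ) : Prop where
  | t0 (hl : l = 0) (hR : Antitone R) (hD : ∀ i, D i = 0) : Good l R D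
  | t1 {x y z k r s d} (t : Ty1 l R D x y z k r s d) : Good l R D
  | t3 {x y z w r s c d} (t : Ty3 l R D x y z w r s c d) : Good l R D
  | t5 {x y z w r c d e} (t : Ty5 l R D x y z w r c d e) : Good l R D

theorem Good.aux {l R D} (g : Good l R D) : Antitone R ∧ Antitone D ∧ ∃ m, ∀ i, m ≤ i → D i = 0 := by
  rcases g with ⟨hl, hR, hD⟩ | t | t | t
  · exact ⟨hR, fun a b _ => by rw [hD, hD], 0, fun i _ => hD i⟩
  · exact ⟨t.aR, t.aD, _, fun i (hi : _ ≤ i) => by rw [t.hD, if_neg (not_lt.2 hi)]⟩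
  · rename_i x y z w r s c d
    refine ⟨t.aR, t.aD, d, fun i hi => ?_⟩
    have := t.cd
    rw [t.hD, if_neg (not_lt.2 hi), if_neg (by omega)]
  · rename_i x y z w r c d e
    refine ⟨t.aR, t.aD, e, fun i hi => ?_⟩
    have := t.cd
    have := t.de
    rw [t.hD, if_neg (not_lt.2 hi), if_neg (by omega), if_neg (by omega)]

theorem Ty1.wex {l R D x y z k r s d} (t : Ty1 l R D x y z k r s d) : ∃ p, Ws l R D p := by
  refine ⟨min s d - 1, (t.ws _).2 ?_⟩
  have := t.rs
  have := t.sL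
  have := t.d0
  have := t.l0
  omega
theorem Ty3.wex {l R D x y z w r s c d} (t : Ty3 l R D x y z w r s c d) : ∃ p, Ws l R D p := by
  refine ⟨c, (t.ws _).2 ?_⟩
  have := t.cs
  have := t.cd
  have := t.l0
  omega
theorem Ty5.wex {l R D x y z w r c d e} (t : Ty5 l R D x y z w r c d e) : ∃ p, Ws l R D p := by
  refine ⟨c, (t.ws _).2 ?_⟩
  have := t.cl
  have := t.cd
  have := t.de
  have := t.l0
  omega

theorem no_ws {l R D l' R' D'} (h : Cmp l R D l' R' D') (hD : ∀ i, D' i = 0)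
    (hw : ∃ p, Ws l R D p) : False := by
  obtain ⟨p, hp⟩ := hw
  have := (h.ws hp).1
  rw [hD] at this
  omega

theorem Good.eq {l R D l' R' D'} (g : Good l R D) (g' : Good l' R' D')
    (h : ∀ ν, Supp l R D ν ↔ Supp l' R' D' ν) : l = l' ∧ R = R' ∧ D = D' := by
  obtain ⟨a1, a2, m, a3⟩ := g.aux
  obtain ⟨b1, b2, m', b3⟩ := g'.aux
  have c := Cmp.mk' a1 a2 b1 b2 a3 h
  have c' := Cmp.mk' b1 b2 a1 a2 b3 (fun ν => (h ν).symm)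
  have hh : ∀ {L L'}, Len l R D L → Len l' R' D' L' → L = L' := fun u v =>
    le_antisymm (Len.le h u v) (Len.le (fun ν => (h ν).symm) v u)
  rcases g with ⟨hl, hR, hD⟩ | t | t | t <;> rcases g' with ⟨hl', hR', hD'⟩ | t' | t' | t'
  · refine ⟨by omega, ?_, ?_⟩
    · funext p
      have := c.T p
      rw [hD, hD'] at this
      exact this
    · funext p
      rw [hD, hD']
  · exact (no_ws c' hD t'.wex).elim
  · exact (no_ws c' hD t'.wex).elim
  · exact (no_ws c' hD t'.wex).elim
  · exact (no_ws c hD' t.wex).elim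
  · exact same1 c c' t t' (hh t.len t'.len)
  · exact (sep13 c c' t t' (hh t.len t'.len)).elim
  · exact (sep15 c c' t t' (hh t.len t'.len)).elim
  · exact (no_ws c hD' t.wex).elim
  · exact (sep13 c' c t' t (hh t.len t'.len).symm).elim
  · exact same3 c c' t t' (hh t.len t'.len)
  · exact (sep35 c c' t t' (hh t.len t'.len)).elim
  · exact (no_ws c hD' t.wex).elim
  · exact (sep15 c' c t' t (hh t.len t'.len).symm).elim
  · exact (sep35 c' c t' t (hh t.len t'.len).symm).elim
  · exact same5 c c' t t' (hh t.len t'.len)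

end

section
/-- Row-count arrays of Littlewood–Richardson fillings of `lam/mu`. -/
structure LRA (lam mu : ℕ → ℕ) (N : ℕ → ℕ → ℕ) : Prop where
  flag : ∀ i v, i < v → N i v = 0
  row : ∀ i, mu i + ∑ v ∈ Finset.range (i + 1), N i v = lam i
  col : ∀ i v, mu (i + 1) + ∑ w ∈ Finset.range (v + 1), N (i + 1) w ≤
    mu i + ∑ w ∈ Finset.range v, N i w
  lat : ∀ i v, ∑ u ∈ Finset.range (i + 1), N u (v + 1) ≤ ∑ u ∈ Finset.range i, N u v

theorem LRA.row' {lam mu N} (h : LRA lam mu N) (i v : ℕ) (hv : i < v) :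
    mu i + ∑ w ∈ Finset.range v, N i w = lam i := by
  rw [sum_range_ext (a := i + 1) hv (fun w hw => h.flag i w hw), h.row]

theorem sum_mono_range (f : ℕ → ℕ) {a b : ℕ} (h : a ≤ b) :
    ∑ i ∈ Finset.range a, f i ≤ ∑ i ∈ Finset.range b, f i :=
  Finset.sum_le_sum_of_subset (by intro x; simp; omega)

theorem LRA.diag {lam mu N} (h : LRA lam mu N) (i s v : ℕ) :
    mu (i + s) + ∑ w ∈ Finset.range (v + s), N (i + s) w ≤
    mu i + ∑ w ∈ Finset.range v, N i w := by
  induction s with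
  | zero => simp
  | succ s ih => exact (h.col (i + s) (v + s)).trans ih

/-- Column sums of the array assembled from the forced part and the free part. -/
theorem colsum {l : ℕ} {R : ℕ → ℕ} {n N : ℕ → ℕ → ℕ}
    (hN : ∀ i v, N i v = (if v = i then R i else 0) + (if l ≤ i then n (i - l) v else 0))
    (m v : ℕ) : ∑ i ∈ Finset.range (l + m), N i v =
      (if v < l + m then R v else 0) + ∑ u ∈ Finset.range m, n u v := by
  simp only [hN, Finset.sum_add_distrib]
  congr 1
  · rw [Finset.sum_ite_eq]; simp
  · rw [Finset.sum_range_add]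
    rw [Finset.sum_eq_zero, zero_add]
    · apply Finset.sum_congr rfl
      intro u _
      simp
    · intro i hi
      rw [Finset.mem_range] at hi
      rw [if_neg (by omega)]

theorem rowsum {l : ℕ} {R : ℕ → ℕ} {n N : ℕ → ℕ → ℕ}
    (hN : ∀ i v, N i v = (if v = i then R i else 0) + (if l ≤ i then n (i - l) v else 0))
    (i v : ℕ) : ∑ w ∈ Finset.range v, N i w =
      (if i < v then R i else 0) + (if l ≤ i then ∑ w ∈ Finset.range v, n (i - l) w else 0) := by
  simp only [hN, Finset.sum_add_distrib]
  congr 1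
  · rw [Finset.sum_ite_eq']; simp
  · split_ifs <;> simp

theorem LRA.toSk {lam mu N} {l k : ℕ} {R D : ℕ → ℕ} (h : LRA lam mu N) (hlam : Antitone lam)
    (hmu : ∀ i, mu i = if i < l then k else 0) (hk : ∀ i, i < l → k ≤ lam i)
    (hR : ∀ i, R i = lam i - k) (hD : ∀ s, D s = min (lam (l + s)) k) :
    ∃ n, Sk l R D n ∧
      ∀ i v, N i v = (if v = i then R i else 0) + (if l ≤ i then n (i - l) v else 0) := by
  have hSle : ∀ i, mu i + ∑ w ∈ Finset.range i, N i w ≤ k := by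
    intro i
    have := h.diag 0 i 0
    simp only [zero_add, Finset.range_zero, Finset.sum_empty, add_zero] at this
    refine this.trans ?_
    rw [hmu]; split_ifs <;> omega
  have hge : ∀ i, R i ≤ N i i := by
    intro i
    have h1 := h.row i
    rw [Finset.sum_range_succ] at h1
    have h2 := hSle i
    rw [hR]; omega
  have hRa : Antitone R := by
    intro a b hab
    rw [hR, hR]
    have := hlam hab
    omega
  have hN : ∀ i v, N i v = (if v = i then R i else 0) +
      (if l ≤ i then (fun s v => N (l + s) v - (if v = l + s then R (l + s) else 0)) (i - l) v
        else 0) := by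
    intro i v
    by_cases hi : l ≤ i
    · simp only [hi, if_true, Nat.add_sub_cancel' hi]
      split_ifs with hv
      · subst hv
        have := hge v
        omega
      · omega
    · rw [if_neg hi]
      have h1 := h.row i
      rw [Finset.sum_range_succ] at h1
      have h2 := hSle i
      have h3 := hmu i
      rw [if_pos (by omega)] at h3
      have h5 := hk i (by omega)
      split_ifs with hv
      · subst hv
        rw [hR]
        omega
      · rcases Nat.lt_or_gt_of_ne hv with hv | hv
        · have h4 := Finset.single_le_sum (f := fun w => N i w) (s := Finset.range i)
            (by simp) (Finset.mem_range.2 hv)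
          omega
        · exact h.flag i v hv
  obtain ⟨n, hn⟩ : ∃ n : ℕ → ℕ → ℕ, n = (fun s v => N (l + s) v -
    (if v = l + s then R (l + s) else 0)) := ⟨_, rfl⟩
  rw [← hn] at hN
  refine ⟨n, ?_, hN⟩
  have hmul : ∀ s, mu (l + s) = 0 := fun s => by rw [hmu, if_neg (by omega)]
  have hrow : ∀ s v, ∑ w ∈ Finset.range v, N (l + s) w =
      (if l + s < v then R (l + s) else 0) + ∑ w ∈ Finset.range v, n s w := by
    intro s v
    rw [rowsum hN]
    simp
  have hhi : ∀ s v, s + l < v → n s v = 0 := by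
    intro s v hv
    have h1 := hN (l + s) v
    rw [h.flag _ _ (by omega)] at h1
    simp only [Nat.le_add_right, if_true, Nat.add_sub_cancel_left] at h1
    omega
  have hrw : ∀ s, ∑ v ∈ Finset.range (s + l + 1), n s v = D s := by
    intro s
    have h1 := hrow s (l + s + 1)
    have h2 := h.row (l + s)
    rw [hmul, h1, if_pos (by omega)] at h2
    rw [Nat.add_comm s l, hD]
    rw [hR] at h2
    omega
  have hDa : ∀ s, D (s + 1) ≤ D s := by
    intro s
    rw [hD, hD]
    have := hlam (show l + s ≤ l + (s + 1) by omega)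
    omega
  refine ⟨?_, hhi, hrw, ?_, ?_⟩
  · intro s v hv
    have h1 := h.diag l s 0
    have h0 := hmul 0
    rw [add_zero] at h0
    rw [hmul, h0] at h1
    simp only [zero_add, Finset.range_zero, Finset.sum_empty] at h1
    have h4 := Finset.single_le_sum (f := fun w => N (l + s) w) (s := Finset.range s)
            (by simp) (Finset.mem_range.2 hv)
    have h5 := hN (l + s) v
    simp only [Nat.le_add_right, if_true, Nat.add_sub_cancel_left] at h5 h4
    omega
  · intro s v
    by_cases hv : v ≤ l + s
    · have h1 := h.col (l + s) v
      have h2 := hrow s v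
      have h3 := hrow (s + 1) (v + 1)
      rw [if_neg (by omega)] at h2 h3
      rw [show l + s + 1 = l + (s + 1) by omega, hmul, hmul] at h1
      omega
    · rw [sum_range_ext (a := s + 1 + l + 1) (b := v + 1) (by omega)
        (fun w hw => hhi _ _ (by omega)), hrw,
        sum_range_ext (a := s + l + 1) (b := v) (by omega)
        (fun w hw => hhi _ _ (by omega)), hrw]
      exact hDa s
  · intro s v
    by_cases hv : v < l + s
    · have h1 := h.lat (l + s) v
      rw [add_assoc, colsum hN, colsum hN, if_pos (by omega), if_pos (by omega)] at h1
      exact h1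
    · rw [Finset.sum_eq_zero (s := Finset.range (s + 1))]
      · have := hRa (Nat.le_succ v)
        simp only [Nat.succ_eq_add_one] at this
        omega
      · intro u hu
        rw [Finset.mem_range] at hu
        exact hhi _ _ (by omega)

theorem Sk.toLRA {lam mu n} {l k : ℕ} {R D : ℕ → ℕ} (h : Sk l R D n) (hlam : Antitone lam)
    (hmu : ∀ i, mu i = if i < l then k else 0) (hk : ∀ i, i < l → k ≤ lam i)
    (hR : ∀ i, R i = lam i - k) (hD : ∀ s, D s = min (lam (l + s)) k) {N : ℕ → ℕ → ℕ}
    (hN : ∀ i v, N i v = (if v = i then R i else 0) + (if l ≤ i then n (i - l) v else 0)) :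
    LRA lam mu N := by
  have hRa : Antitone R := by
    intro a b hab
    rw [hR, hR]
    have := hlam hab
    omega
  have hflag : ∀ i v, i < v → N i v = 0 := by
    intro i v hv
    rw [hN, if_neg (by omega)]
    split_ifs
    · rw [h.hi _ _ (by omega)]
    · rfl
  have hrow : ∀ i v, i < v → mu i + ∑ w ∈ Finset.range v, N i w = lam i := by
    intro i v hv
    rw [rowsum hN, if_pos hv, hmu, hR]
    split_ifs with h1 h2 h2
    · omega
    · have := hk i h1
      omega
    · rw [h.row_eq _ _ (by omega), hD, Nat.add_sub_cancel' h2]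
      omega
    · omega
  refine ⟨hflag, fun i => hrow i _ (by omega), ?_, ?_⟩
  · intro i v
    by_cases hv : i < v
    · rw [hrow _ _ hv, hrow _ _ (by omega)]
      exact hlam (Nat.le_succ i)
    · rw [rowsum hN, rowsum hN, if_neg (by omega), if_neg hv, hmu, hmu]
      by_cases h1 : l ≤ i
      · have := h.col (i - l) v
        rw [if_neg (show ¬ i + 1 < l by omega), if_neg (show ¬ i < l by omega),
          if_pos (show l ≤ i + 1 by omega), if_pos h1,
          show i + 1 - l = i - l + 1 by omega]
        omega
      · rw [if_neg h1, if_pos (show i < l by omega)]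
        by_cases h2 : l ≤ i + 1
        · rw [if_neg (by omega), if_pos h2]
          have := h.row_le (i + 1 - l) (v + 1)
          rw [hD] at this
          omega
        · rw [if_neg h2, if_pos (by omega)]
  · intro i v
    by_cases h1 : l ≤ i
    · obtain ⟨s, rfl⟩ := Nat.exists_eq_add_of_le h1
      rw [add_assoc, colsum hN, colsum hN]
      by_cases hv : v < l + s
      · rw [if_pos (by omega), if_pos hv]
        exact h.lat s v
      · rw [if_neg (by omega), if_neg hv, Finset.sum_eq_zero (s := Finset.range (s + 1))]
        · omega
        · intro u hu
          rw [Finset.mem_range] at hu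
          exact h.hi _ _ (by omega)
    · have e : ∀ m v, m ≤ l → ∑ u ∈ Finset.range m, N u v = if v < m then R v else 0 := by
        intro m v hm
        rw [Finset.sum_congr rfl (g := fun u => if v = u then R u else 0)]
        · rw [Finset.sum_ite_eq]; simp
        · intro u hu
          rw [Finset.mem_range] at hu
          rw [hN, if_neg (show ¬ l ≤ u by omega), add_zero]
      rw [e _ _ (by omega), e _ _ (by omega)]
      have := hRa (Nat.le_succ v)
      simp only [Nat.succ_eq_add_one] at this
      split_ifs <;> omega

/-- Supports in terms of row-count arrays. -/
theorem supp_iff {lam mu} {l k L : ℕ} {R D ν : ℕ → ℕ} (hlam : Antitone lam)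
    (hmu : ∀ i, mu i = if i < l then k else 0) (hk : ∀ i, i < l → k ≤ lam i)
    (hL : ∀ i, L ≤ i → lam i = 0)
    (hR : ∀ i, R i = lam i - k) (hD : ∀ s, D s = min (lam (l + s)) k) :
    Supp l R D ν ↔ ∃ N, LRA lam mu N ∧ ∀ v, ν v = ∑ i ∈ Finset.range L, N i v := by
  have key : ∀ n N, Sk l R D n → LRA lam mu N →
      (∀ i v, N i v = (if v = i then R i else 0) + (if l ≤ i then n (i - l) v else 0)) →
      ∀ v, ∑ i ∈ Finset.range L, N i v = R v + ∑ s ∈ Finset.range (v + 1), n s v := by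
    intro n N h1 h2 hN v
    have e : ∀ i, L ≤ i → N i v = 0 := by
      intro i hi
      have a1 := h2.row' i (max (i + 1) (v + 1)) (by omega)
      have a2 := Finset.single_le_sum (f := fun w => N i w)
        (s := Finset.range (max (i + 1) (v + 1))) (a := v) (by simp) (by simp)
      rw [hL i hi] at a1
      omega
    rw [← sum_range_ext (a := L) (b := l + (L + v + 1)) (by omega) e, colsum hN, if_pos (by omega),
      sum_range_ext (a := v + 1) (b := L + v + 1) (by omega) (fun s hs => h1.lo s v (by omega))]
  constructor
  · rintro ⟨n, h1, h2⟩
    have h3 := h1.toLRA hlam hmu hk hR hD (N := fun i v => (if v = i then R i else 0) +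
      (if l ≤ i then n (i - l) v else 0)) (fun _ _ => rfl)
    exact ⟨_, h3, fun v => by rw [h2, key n _ h1 h3 (fun _ _ => rfl)]⟩
  · rintro ⟨N, h1, h2⟩
    obtain ⟨n, h3, h4⟩ := h1.toSk hlam hmu hk hR hD
    exact ⟨n, h3, fun v => by rw [h2, key n _ h3 h1 h4]⟩

end

section
theorem mem_skew {lam mu : YoungDiagram} {i j : ℕ} :
    (i, j) ∈ skewCells lam mu ↔ mu.rowLen i ≤ j ∧ j < lam.rowLen i := by
  unfold skewCells
  rw [Finset.mem_sdiff, mem_cells, mem_cells, mem_iff_lt_rowLen, mem_iff_lt_rowLen]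
  omega

/-- The number of entries `v+1` in row `i`. -/
noncomputable def rc (lam mu : YoungDiagram) (T : ℕ × ℕ → ℕ) (i v : ℕ) : ℕ :=
  ((Finset.Ico (mu.rowLen i) (lam.rowLen i)).filter fun j => T (i, j) = v + 1).card

theorem rowLen_zero_of {lam : YoungDiagram} {i : ℕ} (h : lam.colLen 0 ≤ i) : lam.rowLen i = 0 := by
  by_contra hc
  have : (i, 0) ∈ lam := mem_iff_lt_rowLen.2 (by omega)
  rw [mem_iff_lt_colLen] at this
  omega

theorem prefix_eq (lam mu : YoungDiagram) (T : ℕ × ℕ → ℕ) (i j v : ℕ) :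
    prefixCount lam mu T i j (v + 1) = ∑ u ∈ Finset.range i, rc lam mu T u v +
      ((Finset.Ico (mu.rowLen i) (lam.rowLen i)).filter fun x => j ≤ x ∧ T (i, x) = v + 1).card := by
  unfold prefixCount
  rw [Finset.card_eq_sum_card_fiberwise (f := Prod.fst) (t := Finset.range (i + 1))]
  · rw [Finset.sum_range_succ]
    congr 1
    · apply Finset.sum_congr rfl
      intro u hu
      rw [Finset.mem_range] at hu
      unfold rc
      symm
      apply Finset.card_bij (fun x _ => (u, x))
      · intro x hx
        simp only [Finset.mem_filter, Finset.mem_Ico, mem_skew] at hx ⊢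
        exact ⟨⟨hx.1, Or.inl hu, hx.2⟩, trivial⟩
      · intro a _ b _ hab
        simpa using hab
      · rintro ⟨a, b⟩ hb
        simp only [Finset.mem_filter, Finset.mem_Ico, mem_skew] at hb ⊢
        obtain ⟨⟨h1, h2, h3⟩, rfl⟩ := hb
        exact ⟨b, ⟨h1, h3⟩, rfl⟩
    · symm
      apply Finset.card_bij (fun x _ => (i, x))
      · intro x hx
        simp only [Finset.mem_filter, Finset.mem_Ico, mem_skew] at hx ⊢
        exact ⟨⟨hx.1, Or.inr ⟨trivial, hx.2.1⟩, hx.2.2⟩, trivial⟩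
      · intro a _ b _ hab
        simpa using hab
      · rintro ⟨a, b⟩ hb
        simp only [Finset.mem_filter, Finset.mem_Ico, mem_skew] at hb ⊢
        obtain ⟨⟨h1, h2, h3⟩, rfl⟩ := hb
        exact ⟨b, ⟨h1, by omega, h3⟩, rfl⟩
  · intro p hp
    simp only [Finset.coe_filter, Finset.coe_range, Set.mem_Iio] at hp ⊢
    have := hp.2.1
    omega

theorem content_eq (lam mu : YoungDiagram) (T : ℕ × ℕ → ℕ) (v : ℕ) :
    content lam mu T (v + 1) = ∑ u ∈ Finset.range (lam.colLen 0), rc lam mu T u v := by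
  have h := prefix_eq lam mu T (lam.colLen 0) 0 v
  have e : Finset.Ico (mu.rowLen (lam.colLen 0)) (lam.rowLen (lam.colLen 0)) = ∅ := by
    rw [rowLen_zero_of le_rfl]; simp
  rw [e, Finset.filter_empty, Finset.card_empty, add_zero] at h
  rw [← h]
  unfold content prefixCount
  congr 1
  ext ⟨a, b⟩
  simp only [Finset.mem_filter, mem_skew]
  constructor
  · rintro ⟨h1, h2⟩
    refine ⟨h1, Or.inl ?_, h2⟩
    by_contra hc
    have := rowLen_zero_of (lam := lam) (i := a) (by omega)
    omega
  · rintro ⟨h1, h2, h3⟩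
    exact ⟨h1, h3⟩

theorem down_closed {a b : ℕ} {P : ℕ → Prop} [DecidablePred P]
    (hP : ∀ x y, a ≤ x → x ≤ y → y < b → P y → P x) (j : ℕ) (h1 : a ≤ j) (h2 : j < b) :
    P j ↔ j < a + ((Finset.Ico a b).filter P).card := by
  constructor
  · intro hj
    have : Finset.Ico a (j + 1) ⊆ (Finset.Ico a b).filter P := by
      intro x hx
      simp only [Finset.mem_filter, Finset.mem_Ico] at hx ⊢
      exact ⟨by omega, hP x j hx.1 (by omega) h2 hj⟩
    have := Finset.card_le_card this
    rw [Nat.card_Ico] at this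
    omega
  · intro hj
    by_contra hc
    have : (Finset.Ico a b).filter P ⊆ Finset.Ico a j := by
      intro x hx
      simp only [Finset.mem_filter, Finset.mem_Ico] at hx ⊢
      refine ⟨hx.1.1, ?_⟩
      by_contra hx2
      exact hc (hP j x h1 (by omega) hx.1.2 hx.2)
    have := Finset.card_le_card this
    rw [Nat.card_Ico] at this
    omega

theorem ssyt_sum {lam mu : YoungDiagram} {T : ℕ × ℕ → ℕ} (h : IsSSYT lam mu T) (i v : ℕ) :
    ∑ w ∈ Finset.range v, rc lam mu T i w =
      ((Finset.Ico (mu.rowLen i) (lam.rowLen i)).filter fun j => T (i, j) ≤ v).card := by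
  rw [Finset.card_eq_sum_card_fiberwise (f := fun j => T (i, j) - 1) (t := Finset.range v)]
  · apply Finset.sum_congr rfl
    intro w hw
    rw [Finset.mem_range] at hw
    unfold rc
    congr 1
    ext j
    simp only [Finset.mem_filter, Finset.mem_Ico]
    constructor
    · rintro ⟨h1, h2⟩
      exact ⟨⟨h1, by omega⟩, by omega⟩
    · rintro ⟨⟨h1, h2⟩, h3⟩
      have := (h.1 (i, j)).1 (mem_skew.2 h1)
      exact ⟨h1, by omega⟩
  · intro j hj
    simp only [Finset.coe_filter, Finset.mem_Ico, Finset.coe_range, Set.mem_Iio] at hj ⊢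
    have := (h.1 (i, j)).1 (mem_skew.2 hj.1)
    have := hj.2
    omega

theorem ssyt_le_iff {lam mu : YoungDiagram} {T : ℕ × ℕ → ℕ} (h : IsSSYT lam mu T) {i j : ℕ}
    (hj : (i, j) ∈ skewCells lam mu) (v : ℕ) :
    T (i, j) ≤ v ↔ j < mu.rowLen i + ∑ w ∈ Finset.range v, rc lam mu T i w := by
  rw [ssyt_sum h]
  rw [mem_skew] at hj
  exact down_closed (P := fun j => T (i, j) ≤ v) (fun x y h1 h2 h3 h4 =>
    (h.2.1 i x y (mem_skew.2 ⟨h1, by omega⟩) (mem_skew.2 ⟨by omega, h3⟩) h2).trans h4) j hj.1 hj.2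

theorem lr_bound {lam mu : YoungDiagram} {T : ℕ × ℕ → ℕ} (h : IsSSYT lam mu T)
    (hl : IsLattice lam mu T) (i : ℕ) : ∀ j, T (i, j) ≤ i + 1 := by
  induction i using Nat.strong_induction_on with
  | _ i ih =>
    intro j
    by_contra hc
    have hcell : (i, j) ∈ skewCells lam mu := (h.1 _).2 (by omega)
    obtain ⟨t, ht⟩ : ∃ t, T (i, j) = t + 2 := ⟨T (i, j) - 2, by omega⟩
    have h1 : 0 < prefixCount lam mu T i j (t + 2) := by
      apply Finset.card_pos.2
      refine ⟨(i, j), ?_⟩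
      rw [Finset.mem_filter]
      exact ⟨hcell, Or.inr ⟨rfl, le_rfl⟩, ht⟩
    have h2 := lt_of_lt_of_le h1 (hl i j t)
    obtain ⟨⟨a, b⟩, hab⟩ := Finset.card_pos.1 h2
    rw [Finset.mem_filter] at hab
    obtain ⟨h3, h4, h5⟩ := hab
    rcases h4 with h4 | ⟨h4, h6⟩
    · have := ih a h4 b
      simp only at h4
      omega
    · simp only at h4 h6
      subst h4
      have := h.2.1 a j b hcell h3 h6
      omega

theorem LRA.of_lr {lam mu : YoungDiagram} {T : ℕ × ℕ → ℕ} (hle : mu ≤ lam) (h : IsSSYT lam mu T)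
    (hl : IsLattice lam mu T) : LRA lam.rowLen mu.rowLen (rc lam mu T) := by
  have hml : ∀ i, mu.rowLen i ≤ lam.rowLen i := by
    intro i
    by_contra hc
    have h1 : (i, lam.rowLen i) ∈ mu := mem_iff_lt_rowLen.2 (by omega)
    have h2 : (i, lam.rowLen i) ∈ lam := hle h1
    rw [mem_iff_lt_rowLen] at h2
    omega
  have hrow : ∀ i, mu.rowLen i + ∑ v ∈ Finset.range (i + 1), rc lam mu T i v = lam.rowLen i := by
    intro i
    rw [ssyt_sum h, Finset.filter_true_of_mem (fun j _ => lr_bound h hl i j), Nat.card_Ico]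
    have := hml i
    omega
  refine ⟨?_, hrow, ?_, ?_⟩
  · intro i v hv
    unfold rc
    rw [Finset.card_eq_zero, Finset.filter_eq_empty_iff]
    intro j _ hj
    have := lr_bound h hl i j
    omega
  · intro i v
    by_contra hc
    have hle' : mu.rowLen (i + 1) + ∑ w ∈ Finset.range (v + 1), rc lam mu T (i + 1) w ≤
        lam.rowLen (i + 1) := by
      rw [ssyt_sum h]
      have := Finset.card_filter_le (Finset.Ico (mu.rowLen (i + 1)) (lam.rowLen (i + 1)))
        (fun j => T (i + 1, j) ≤ v + 1)
      rw [Nat.card_Ico] at this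
      have := hml (i + 1)
      omega
    obtain ⟨x, hx⟩ : ∃ x, x = mu.rowLen i + ∑ w ∈ Finset.range v, rc lam mu T i w := ⟨_, rfl⟩
    have m1 := mu.rowLen_anti i (i + 1) (by omega)
    have m2 := lam.rowLen_anti i (i + 1) (by omega)
    have c1 : (i + 1, x) ∈ skewCells lam mu := mem_skew.2 ⟨by omega, by omega⟩
    have c2 : (i, x) ∈ skewCells lam mu := mem_skew.2 ⟨by omega, by omega⟩
    have e1 := (ssyt_le_iff h c1 (v + 1)).2 (by omega)
    have e2 := h.2.2 i (i + 1) x c2 c1 (by omega)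
    have e3 := (ssyt_le_iff h c2 v).1 (by omega)
    omega
  · intro i v
    have h1 := hl i (mu.rowLen i + ∑ w ∈ Finset.range (v + 1), rc lam mu T i w) v
    rw [prefix_eq, prefix_eq] at h1
    have hiff : ∀ j, (i, j) ∈ skewCells lam mu → _ := fun j hj => ssyt_le_iff h hj (v + 1)
    generalize mu.rowLen i + ∑ w ∈ Finset.range (v + 1), rc lam mu T i w = y at h1 hiff
    have hemp : ((Finset.Ico (mu.rowLen i) (lam.rowLen i)).filter
        fun x => y ≤ x ∧ T (i, x) = v + 1) = ∅ := by
      rw [Finset.filter_eq_empty_iff]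
      rintro j hj ⟨h2, h3⟩
      rw [Finset.mem_Ico] at hj
      have := (hiff j (mem_skew.2 hj)).1 (by omega)
      omega
    rw [hemp, Finset.card_empty, add_zero] at h1
    · rw [Finset.sum_range_succ]
      refine le_trans (Nat.add_le_add_left (Finset.card_le_card ?_) _) h1
      intro j hj
      simp only [Finset.mem_filter, Finset.mem_Ico] at hj ⊢
      refine ⟨hj.1, ?_, hj.2⟩
      by_contra hc
      have := (hiff j (mem_skew.2 hj.1)).2 (by omega)
      omega

theorem LRA.to_lr {lam mu : YoungDiagram} {N : ℕ → ℕ → ℕ}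
    (h : LRA lam.rowLen mu.rowLen N) :
    ∃ T, IsSSYT lam mu T ∧ IsLattice lam mu T ∧ ∀ i v, rc lam mu T i v = N i v := by
  obtain ⟨S, hS⟩ : ∃ S : ℕ → ℕ → ℕ, ∀ i v, S i v = mu.rowLen i + ∑ w ∈ Finset.range v, N i w :=
    ⟨_, fun _ _ => rfl⟩
  have S0 : ∀ i, S i 0 = mu.rowLen i := fun i => by rw [hS]; simp
  have Ss : ∀ i v, S i (v + 1) = S i v + N i v := fun i v => by
    rw [hS, hS, Finset.sum_range_succ]; ring
  have Sm : ∀ i, Monotone (S i) := fun i => monotone_nat_of_le_succ (fun v => by rw [Ss]; omega)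
  have Sl : ∀ i v, i < v → S i v = lam.rowLen i := fun i v hv => by rw [hS, h.row' i v hv]
  have Sle : ∀ i v, S i v ≤ lam.rowLen i := by
    intro i v
    rw [← Sl i (max v (i + 1)) (by omega)]
    exact Sm i (by omega)
  have Sc : ∀ i v, S (i + 1) (v + 1) ≤ S i v := fun i v => by rw [hS, hS]; exact h.col i v
  have Sa : ∀ v, Antitone (fun i => S i v) := by
    intro v
    apply antitone_nat_of_succ_le
    intro i
    cases v with
    | zero => rw [S0, S0]; exact mu.rowLen_anti i (i + 1) (by omega)
    | succ v => exact (Sc i v).trans (Sm i (by omega))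
  obtain ⟨T, hT⟩ : ∃ T : ℕ × ℕ → ℕ, ∀ i j, T (i, j) =
      if hh : ∃ v, j < S i v then Nat.find hh else 0 :=
    ⟨fun p => if hh : ∃ v, p.2 < S p.1 v then Nat.find hh else 0, fun _ _ => rfl⟩
  have Tle : ∀ i j, j < lam.rowLen i → ∀ v, T (i, j) ≤ v ↔ j < S i v := by
    intro i j hj v
    have hh : ∃ v, j < S i v := ⟨i + 1, by rw [Sl i _ (by omega)]; exact hj⟩
    rw [hT, dif_pos hh, Nat.find_le_iff]
    constructor
    · rintro ⟨m, h1, h2⟩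
      exact lt_of_lt_of_le h2 (Sm i h1)
    · intro h1
      exact ⟨v, le_rfl, h1⟩
  have T1 : ∀ p, p ∈ skewCells lam mu ↔ T p ≠ 0 := by
    rintro ⟨i, j⟩
    rw [mem_skew]
    by_cases hj : j < lam.rowLen i
    · have := Tle i j hj 0
      rw [S0] at this
      omega
    · have : T (i, j) = 0 := by
        rw [hT, dif_neg]
        rintro ⟨v, hv⟩
        have := Sle i v
        omega
      omega
  have hrc : ∀ i v, rc lam mu T i v = N i v := by
    intro i v
    unfold rc
    have : (Finset.Ico (mu.rowLen i) (lam.rowLen i)).filter (fun j => T (i, j) = v + 1) =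
        Finset.Ico (S i v) (S i (v + 1)) := by
      ext j
      simp only [Finset.mem_filter, Finset.mem_Ico]
      have a1 := Sle i (v + 1)
      have a2 := Sm i (Nat.zero_le v)
      rw [S0] at a2
      constructor
      · rintro ⟨h1, h2⟩
        have b1 := Tle i j h1.2 v
        have b2 := Tle i j h1.2 (v + 1)
        omega
      · rintro ⟨h1, h2⟩
        have b1 := Tle i j (by omega) v
        have b2 := Tle i j (by omega) (v + 1)
        omega
    rw [this, Nat.card_Ico, Ss]
    omega
  refine ⟨T, ⟨T1, ?_, ?_⟩, ?_, hrc⟩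
  · intro i j1 j2 h1 h2 h12
    rw [mem_skew] at h1 h2
    rw [Tle i j1 h1.2]
    have := (Tle i j2 h2.2 _).1 le_rfl
    omega
  · intro i1 i2 j h1 h2 h12
    have hne := (T1 _).1 h2
    rw [mem_skew] at h1 h2
    obtain ⟨v, hv⟩ : ∃ v, T (i2, j) = v + 1 := ⟨T (i2, j) - 1, by omega⟩
    have a1 := (Tle i2 j h2.2 (v + 1)).1 (by omega)
    have a2 : S i2 (v + 1) ≤ S (i1 + 1) (v + 1) := Sa (v + 1) h12
    have a3 := Sc i1 v
    have := (Tle i1 j h1.2 v).2 (by omega)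
    omega
  · intro i j k
    rw [prefix_eq, prefix_eq]
    simp only [hrc]
    have h1 := h.lat i k
    rw [Finset.sum_range_succ, ← hrc i (k + 1)] at h1
    have h2 : ((Finset.Ico (mu.rowLen i) (lam.rowLen i)).filter
        fun x => j ≤ x ∧ T (i, x) = k + 1 + 1).card ≤ rc lam mu T i (k + 1) := by
      apply Finset.card_le_card
      intro x hx
      simp only [Finset.mem_filter] at hx ⊢
      exact ⟨hx.1, hx.2.2⟩
    omega

theorem lr_finite (lam mu nu : YoungDiagram) : {T : ℕ × ℕ → ℕ | IsLR lam mu nu T}.Finite := by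
  apply Set.Finite.of_finite_image (f := fun T => (skewCells lam mu).image (fun p => (p, T p)))
  · apply Set.Finite.subset (Finset.finite_toSet ((skewCells lam mu) ×ˢ
      Finset.range ((skewCells lam mu).sup Prod.fst + 2)).powerset)
    rintro _ ⟨T, hT, rfl⟩
    simp only [Finset.coe_powerset, Set.mem_preimage, Set.mem_powerset_iff, Finset.coe_subset]
    intro q hq
    obtain ⟨p, hp, rfl⟩ := Finset.mem_image.1 hq
    have h1 : T p ≤ p.1 + 1 := lr_bound hT.1 hT.2.1 p.1 p.2
    have h2 := Finset.le_sup (f := Prod.fst) hp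
    simp only [Finset.mem_product, Finset.mem_range]
    exact ⟨hp, by omega⟩
  · intro T hT T' hT' he
    funext p
    by_cases hp : p ∈ skewCells lam mu
    · have h1 : (p, T p) ∈ (skewCells lam mu).image (fun p => (p, T p)) :=
        Finset.mem_image.2 ⟨p, hp, rfl⟩
      simp only at he
      rw [he] at h1
      obtain ⟨q, _, hq⟩ := Finset.mem_image.1 h1
      simp only [Prod.mk.injEq] at hq
      rw [← hq.2, hq.1]
    · have h1 := (hT.1.1 p).not.1 hp
      have h2 := (hT'.1.1 p).not.1 hp
      omega

theorem lr_ne_zero {lam mu nu : YoungDiagram} (hle : mu ≤ lam) :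
    lrCoeff lam mu nu ≠ 0 ↔ ∃ N, LRA lam.rowLen mu.rowLen N ∧
      ∀ v, nu.rowLen v = ∑ i ∈ Finset.range (lam.colLen 0), N i v := by
  unfold lrCoeff
  rw [if_pos hle, ← Nat.pos_iff_ne_zero, Set.ncard_pos (lr_finite lam mu nu)]
  constructor
  · rintro ⟨T, h1, h2, h3⟩
    exact ⟨_, LRA.of_lr hle h1 h2, fun v => by rw [← h3, content_eq]⟩
  · rintro ⟨N, h1, h2⟩
    obtain ⟨T, a, b, c⟩ := h1.to_lr
    refine ⟨T, a, b, fun i => ?_⟩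
    rw [content_eq, h2]
    simp only [c]

theorem exists_young (ν : ℕ → ℕ) (M : ℕ) (hν : Antitone ν) (hM : ∀ i, M ≤ i → ν i = 0) :
    ∃ Y : YoungDiagram, ∀ i, Y.rowLen i = ν i := by
  have hlow : IsLowerSet (((Finset.range M ×ˢ Finset.range (ν 0)).filter
      fun p => p.2 < ν p.1 : Finset (ℕ × ℕ)) : Set (ℕ × ℕ)) := by
    rintro ⟨a, b⟩ ⟨c, d⟩ hba ha
    obtain ⟨h1, h2⟩ := Prod.mk_le_mk.1 hba
    simp only [Finset.mem_coe, Finset.mem_filter, Finset.mem_product, Finset.mem_range] at ha ⊢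
    have := hν h1
    exact ⟨⟨by omega, by omega⟩, by omega⟩
  refine ⟨⟨_, hlow⟩, fun i => ?_⟩
  have hmem : ∀ j, j < (YoungDiagram.mk _ hlow).rowLen i ↔ j < ν i := by
    intro j
    rw [← mem_iff_lt_rowLen, ← mem_cells]
    simp only [Finset.mem_filter, Finset.mem_product, Finset.mem_range]
    constructor
    · exact fun h => h.2
    · intro h
      have h0 := hν (Nat.zero_le i)
      refine ⟨⟨?_, by omega⟩, h⟩
      by_contra hc
      rw [hM i (by omega)] at h
      omega
  have h1 := hmem (ν i)
  have h2 := hmem ((YoungDiagram.mk _ hlow).rowLen i)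
  omega

theorem LRA.young {lam mu : ℕ → ℕ} {N : ℕ → ℕ → ℕ} {L : ℕ} (h : LRA lam mu N) :
    ∃ Y : YoungDiagram, ∀ v, Y.rowLen v = ∑ i ∈ Finset.range L, N i v := by
  apply exists_young _ L
  · apply antitone_nat_of_succ_le
    intro v
    exact (sum_mono_range (fun u => N u (v + 1)) (Nat.le_succ L)).trans (h.lat L v)
  · intro v hv
    apply Finset.sum_eq_zero
    intro i hi
    rw [Finset.mem_range] at hi
    exact h.flag i v (by omega)

theorem schur_supp {lam mu alp bet : YoungDiagram} (hmu : mu ≤ lam) (hbet : bet ≤ alp)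
    (h : SchurEq lam mu alp bet) {l k l' k' : ℕ} {R D R' D' : ℕ → ℕ}
    (h1 : ∀ i, mu.rowLen i = if i < l then k else 0) (h2 : ∀ i, i < l → k ≤ lam.rowLen i)
    (hR : ∀ i, R i = lam.rowLen i - k) (hD : ∀ s, D s = min (lam.rowLen (l + s)) k)
    (h1' : ∀ i, bet.rowLen i = if i < l' then k' else 0) (h2' : ∀ i, i < l' → k' ≤ alp.rowLen i)
    (hR' : ∀ i, R' i = alp.rowLen i - k') (hD' : ∀ s, D' s = min (alp.rowLen (l' + s)) k')
    (ν : ℕ → ℕ) : Supp l R D ν ↔ Supp l' R' D' ν := by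
  rw [supp_iff (fun a b => lam.rowLen_anti a b) h1 h2 (fun i => rowLen_zero_of) hR hD,
    supp_iff (fun a b => alp.rowLen_anti a b) h1' h2' (fun i => rowLen_zero_of) hR' hD']
  constructor
  · rintro ⟨N, a, b⟩
    obtain ⟨Y, hY⟩ := a.young (L := lam.colLen 0)
    have e := (lr_ne_zero (nu := Y) hmu).2 ⟨N, a, hY⟩
    rw [h Y, lr_ne_zero hbet] at e
    obtain ⟨N', a', b'⟩ := e
    exact ⟨N', a', fun v => by rw [b, ← hY, b']⟩
  · rintro ⟨N, a, b⟩
    obtain ⟨Y, hY⟩ := a.young (L := alp.colLen 0)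
    have e := (lr_ne_zero (nu := Y) hbet).2 ⟨N, a, hY⟩
    rw [← h Y, lr_ne_zero hmu] at e
    obtain ⟨N', a', b'⟩ := e
    exact ⟨N', a', fun v => by rw [b, ← hY, b']⟩

end

/-- `f` is a partition with exactly three distinct part sizes. -/
structure Three (f : ℕ → ℕ) (L a b c m1 m2 : ℕ) : Prop where
  ab : b < a
  bc : c < b
  c0 : 0 < c
  m0 : 0 < m1
  m12 : m1 < m2
  m2L : m2 < L
  hf : ∀ i, f i = if i < m1 then a else if i < m2 then b else if i < L then c else 0

theorem three_aux {f : ℕ → ℕ} {L a b c : ℕ} (hf : Antitone f) (hpos : ∀ i, i < L ↔ 0 < f i)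
    (ab : b < a) (bc : c < b) (h : ∀ i, i < L → f i = a ∨ f i = b ∨ f i = c)
    (ha : ∃ i, i < L ∧ f i = a) (hb : ∃ i, i < L ∧ f i = b) (hc : ∃ i, i < L ∧ f i = c) :
    ∃ m1 m2, Three f L a b c m1 m2 := by
  obtain ⟨ia, ha, ha'⟩ := ha
  obtain ⟨ib, hb, hb'⟩ := hb
  obtain ⟨ic, hc, hc'⟩ := hc
  have hd : ∀ t, ∃ m, ∀ i, i < L → (t ≤ f i ↔ i < m) := by
    intro t
    refine ⟨((Finset.Ico 0 L).filter fun i => t ≤ f i).card, fun i hi => ?_⟩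
    have := down_closed (a := 0) (b := L) (P := fun i => t ≤ f i)
      (fun x y _ hxy _ hy => hy.trans (hf hxy)) i (Nat.zero_le i) hi
    rw [zero_add] at this
    exact this
  obtain ⟨m1, h1⟩ := hd a
  obtain ⟨m2, h2⟩ := hd b
  have e1 := h1 ia ha
  have e2 := h1 ib hb
  have e3 := h2 ib hb
  have e4 := h2 ic hc
  have hcp := (hpos ic).1 hc
  have e5 : m2 < L := by omega
  refine ⟨m1, m2, ab, bc, by omega, by omega, by omega, e5, fun i => ?_⟩
  by_cases hi : i < L
  · have g1 := h1 i hi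
    have g2 := h2 i hi
    have g3 := h i hi
    split_ifs <;> omega
  · have := (hpos i).not.1 hi
    have g4 : ¬ i < m2 := by omega
    have g5 : ¬ i < m1 := by omega
    rw [if_neg g5, if_neg g4, if_neg hi]
    omega

theorem dp_three {lam : YoungDiagram} (h : dp lam = 3) :
    ∃ a b c m1 m2, Three lam.rowLen (lam.colLen 0) a b c m1 m2 := by
  have hpos : ∀ i, i < lam.colLen 0 ↔ 0 < lam.rowLen i := by
    intro i
    rw [← mem_iff_lt_rowLen, ← mem_iff_lt_colLen]
  have hanti : Antitone lam.rowLen := fun a b => lam.rowLen_anti a b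
  unfold dp at h
  obtain ⟨x, y, z, hxy, hxz, hyz, hS⟩ := Finset.card_eq_three.1 h
  have hm : ∀ t, t ∈ ({x, y, z} : Finset ℕ) ↔ ∃ i, i < lam.colLen 0 ∧ lam.rowLen i = t := by
    intro t
    rw [← hS, Finset.mem_image]
    simp
  have hx := (hm x).1 (by simp)
  have hy := (hm y).1 (by simp)
  have hz := (hm z).1 (by simp)
  have hall : ∀ i, i < lam.colLen 0 → lam.rowLen i = x ∨ lam.rowLen i = y ∨ lam.rowLen i = z := by
    intro i hi
    have := (hm (lam.rowLen i)).2 ⟨i, hi, rfl⟩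
    simpa using this
  rcases Nat.lt_or_gt_of_ne hxy with h1 | h1 <;> rcases Nat.lt_or_gt_of_ne hxz with h2 | h2 <;>
    rcases Nat.lt_or_gt_of_ne hyz with h3 | h3
  · exact ⟨z, y, x, three_aux hanti hpos h3 h1 (fun i hi => by have := hall i hi; tauto) hz hy hx⟩
  · exact ⟨y, z, x, three_aux hanti hpos h3 h2 (fun i hi => by have := hall i hi; tauto) hy hz hx⟩
  · omega
  · exact ⟨y, x, z, three_aux hanti hpos h1 h2 (fun i hi => by have := hall i hi; tauto) hy hx hz⟩
  · exact ⟨z, x, y, three_aux hanti hpos h2 h1 (fun i hi => by have := hall i hi; tauto) hz hx hy⟩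
  · omega
  · exact ⟨x, z, y, three_aux hanti hpos h2 h3 (fun i hi => by have := hall i hi; tauto) hx hz hy⟩
  · exact ⟨x, y, z, three_aux hanti hpos h1 h3 (fun i hi => by have := hall i hi; tauto) hx hy hz⟩

theorem Three.good {f : ℕ → ℕ} {L a b c m1 m2 l k : ℕ} (t : Three f L a b c m1 m2)
    (hl : 0 < l) (hk : 0 < k) (hlL : l < L) (hkl : k < f l) :
    Good l (fun i => f i - k) (fun s => min (f (l + s)) k) := by
  obtain ⟨ab, bc, c0, m0, m12, m2L, hf⟩ := t
  rw [hf] at hkl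
  by_cases h1 : k ≤ c
  · refine Good.t1 (x := a - b) (y := b - c) (z := c - k) (k := k) (r := m1) (s := m2) (d := L - l)
      ⟨hl, by omega, by omega, hk, m0, m12, by omega, by omega, ?_, ?_, ?_⟩
    · intro hz
      split_ifs at hkl <;> omega
    · intro i
      simp only [hf]
      clear hkl
      split_ifs <;> omega
    · intro i
      simp only [hf]
      clear hkl
      split_ifs <;> omega
  · by_cases h2 : k < b
    · have h3 : l < m2 := by split_ifs at hkl <;> omega
      refine Good.t3 (x := a - b) (y := b - k) (z := k - c) (w := c) (r := m1) (s := m2)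
        (c := m2 - l) (d := L - l) ⟨hl, by omega, by omega, by omega, c0, m0, m12, by omega,
        by omega, by omega, ?_, ?_⟩
      · intro i
        simp only [hf]
        clear hkl
        split_ifs <;> omega
      · intro i
        simp only [hf]
        clear hkl
        split_ifs <;> omega
    · have h3 : l < m1 := by split_ifs at hkl <;> omega
      rw [if_pos h3] at hkl
      refine Good.t5 (x := a - k) (y := k - b) (z := b - c) (w := c) (r := m1) (c := m1 - l)
        (d := m2 - l) (e := L - l) ⟨hl, by omega, by omega, c0, by omega, by omega, by omega,
        by omega, ?_, ?_⟩
      · intro i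
        simp only [hf]
        split_ifs <;> omega
      · intro i
        simp only [hf]
        split_ifs <;> omega

theorem young_ext {a b : YoungDiagram} (h : ∀ i, a.rowLen i = b.rowLen i) : a = b := by
  apply YoungDiagram.ext
  ext ⟨i, j⟩
  rw [mem_cells, mem_cells, mem_iff_lt_rowLen, mem_iff_lt_rowLen, h]

/-- The data of a skew diagram as in the theorem. -/
theorem shape_data {lam mu : YoungDiagram} (hdp : dp lam = 3) (hrect : IsRect mu)
    (hbasic : IsBasic lam mu) (hconn : IsConnectedSkew lam mu) :
    ∃ l k, (∀ i, mu.rowLen i = if i < l then k else 0) ∧ (∀ i, i < l → k ≤ lam.rowLen i) ∧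
      Good l (fun i => lam.rowLen i - k) (fun s => min (lam.rowLen (l + s)) k) ∧
      ((l = 0 ∧ k = 0) ∨ (0 < l ∧ k < lam.rowLen l)) := by
  have hr : ∀ i, mu.rowLen i = if i < mu.colLen 0 then mu.rowLen 0 else 0 := by
    intro i
    split_ifs with h
    · exact hrect i h
    · exact rowLen_zero_of (by omega)
  refine ⟨mu.colLen 0, mu.rowLen 0, hr, ?_⟩
  obtain ⟨a, b, c, m1, m2, t⟩ := dp_three hdp
  rcases Nat.eq_zero_or_pos (mu.colLen 0) with h0 | h0
  · have hk : mu.rowLen 0 = 0 := rowLen_zero_of (by omega)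
    rw [h0, hk]
    refine ⟨fun i hi => by omega, Good.t0 rfl ?_ (fun i => by simp), Or.inl ⟨rfl, rfl⟩⟩
    intro i j hij
    exact lam.rowLen_anti i j hij
  · have hk : 0 < mu.rowLen 0 := by
      rw [← mem_iff_lt_rowLen, mem_iff_lt_colLen]; exact h0
    have hpos : 0 < lam.rowLen 0 := by
      rw [t.hf, if_pos t.m0]
      have := t.ab
      omega
    have hlL := hbasic.2 0 hpos
    have hkl : mu.rowLen 0 < lam.rowLen (mu.colLen 0) := by
      have h1 := hconn (mu.colLen 0 - 1) (by omega)
      rw [hr, if_pos (by omega), Nat.sub_add_cancel h0] at h1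
      exact h1
    refine ⟨fun i hi => ?_, t.good h0 hk hlL hkl, Or.inr ⟨h0, hkl⟩⟩
    have := lam.rowLen_anti i (mu.colLen 0) hi.le
    omega

/-- two basic connected skew diagrams whose outer shapes both have exactly 3
distinct part sizes and whose inner shapes are rectangles are equal whenever their skew
Schur functions agree. -/
theorem dp_three_three_eq (lam mu alp bet : YoungDiagram)
    (hmu : mu ≤ lam) (hbet : bet ≤ alp)
    (hdplam : dp lam = 3) (hdpalp : dp alp = 3)
    (hrectmu : IsRect mu) (hrectbet : IsRect bet)
    (hbasic1 : IsBasic lam mu) (hconn1 : IsConnectedSkew lam mu)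
    (hbasic2 : IsBasic alp bet) (hconn2 : IsConnectedSkew alp bet)
    (h : SchurEq lam mu alp bet) :
    alp = lam ∧ bet = mu := by
  obtain ⟨l, k, h1, h2, g, h3⟩ := shape_data hdplam hrectmu hbasic1 hconn1
  obtain ⟨l', k', h1', h2', g', h3'⟩ := shape_data hdpalp hrectbet hbasic2 hconn2
  obtain ⟨rfl, hR, hD⟩ := g.eq g' (fun ν => schur_supp hmu hbet h h1 h2 (fun _ => rfl)
    (fun _ => rfl) h1' h2' (fun _ => rfl) (fun _ => rfl) ν)
  have hR' : ∀ i, lam.rowLen i - k = alp.rowLen i - k' := fun i => congrFun hR i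
  have hD' : ∀ i, min (lam.rowLen (l + i)) k = min (alp.rowLen (l + i)) k' :=
    fun i => congrFun hD i
  have hk : k = k' := by
    have := hD' 0
    rw [add_zero] at this
    omega
  subst hk
  constructor
  · apply young_ext
    intro i
    have e1 := hR' i
    by_cases hi : i < l
    · have := h2 i hi
      have := h2' i hi
      omega
    · have e2 := hD' (i - l)
      rw [Nat.add_sub_cancel' (by omega)] at e2
      omega
  · apply young_ext
    intro i
    rw [h1, h1']

end LRSkew
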